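/- arXiv:1910.12480 — 2 statements merged into one kernel-verified Lean document; each statement's English description precedes it below -/
import Mathlib

section
/- Every triangle-free planar graph is 3-colourable (Grötzsch's theorem). -/
structure PlaneEmbedding {V : Type} (G : SimpleGraph V) where
  pos : V → ℝ × ℝ
  arc : V → V → Set.Icc (0:ℝ) 1 → ℝ × ℝ
  pos_inj : Function.Injective pos
  arc_cont : ∀ u v, G.Adj u v → Continuous (arc u v)
  arc_inj : ∀ u v, G.Adj u v → Function.Injective (arc u v)
  arc_start : ∀ u v, G.Adj u v → arc u v ⟨0, by norm_num⟩ = pos u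
  arc_end : ∀ u v, G.Adj u v → arc u v ⟨1, by norm_num⟩ = pos v
  arc_symm : ∀ u v, G.Adj u v → Set.range (arc u v) = Set.range (arc v u)
  arc_avoid : ∀ u v w, G.Adj u v → w ≠ u → w ≠ v → pos w ∉ Set.range (arc u v)
  arcs_meet_only_at_endpoints : ∀ u v x y, G.Adj u v → G.Adj x y →
    ({u, v} : Set V) ≠ {x, y} →
    Set.range (arc u v) ∩ Set.range (arc x y) ⊆ pos '' (({u, v} : Set V) ∩ {x, y})

/-- A graph is planar if it admits a drawing in the plane. -/
def SimpleGraph.IsPlanar {V : Type} (G : SimpleGraph V) : Prop := Nonempty (PlaneEmbedding G)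

open Classical in
/-- The number of ordered pairs of adjacent vertices inside `R`. -/
noncomputable def SimpleGraph.adjPairs {V : Type} (G : SimpleGraph V) (R S : Finset V) : ℤ :=
  ∑ a ∈ R, ∑ b ∈ S, if G.Adj a b then 1 else 0

/-- The Kostochka-Yancey potential `5 |R| - 3 |E(G[R])|` of a vertex set. -/
noncomputable def SimpleGraph.potential {V : Type} (G : SimpleGraph V) (R : Finset V) : ℤ :=
  5 * R.card - 3 * (G.adjPairs R R / 2)

/-- `φ` is a proper 3-colouring of the subgraph induced on `R`. -/
def SimpleGraph.ProperOn {V : Type} (G : SimpleGraph V) (R : Finset V) (φ : V → Fin 3) : Prop :=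
  ∀ a ∈ R, ∀ b ∈ R, G.Adj a b → φ a ≠ φ b

/-- The subgraph induced on `R` is 3-colourable. -/
def SimpleGraph.ColorableOn {V : Type} (G : SimpleGraph V) (R : Finset V) : Prop :=
  ∃ φ : V → Fin 3, G.ProperOn R φ

namespace SimpleGraph

variable {V : Type} {G : SimpleGraph V} {A B R S : Finset V}

lemma adjPairs_nonneg : 0 ≤ G.adjPairs R S :=
  Finset.sum_nonneg fun _ _ => Finset.sum_nonneg fun _ _ => by split_ifs <;> simp

lemma adjPairs_comm : G.adjPairs R S = G.adjPairs S R := by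
  classical
  unfold adjPairs
  rw [Finset.sum_comm]
  exact Finset.sum_congr rfl fun a _ => Finset.sum_congr rfl fun b _ =>
    if_congr (G.adj_comm b a) rfl rfl

lemma adjPairs_mono_left (h : R ⊆ S) : G.adjPairs R B ≤ G.adjPairs S B :=
  Finset.sum_le_sum_of_subset_of_nonneg h
    fun _ _ _ => Finset.sum_nonneg fun _ _ => by split_ifs <;> simp

lemma adjPairs_mono_right (h : R ⊆ S) : G.adjPairs B R ≤ G.adjPairs B S := by
  rw [adjPairs_comm, adjPairs_comm (R := B)]
  exact adjPairs_mono_left h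

lemma adjPairs_congr {G' : SimpleGraph V} (h : ∀ a ∈ R, ∀ b ∈ S, (G.Adj a b ↔ G'.Adj a b)) :
    G.adjPairs R S = G'.adjPairs R S := by
  classical
  exact Finset.sum_congr rfl fun a ha => Finset.sum_congr rfl fun b hb =>
    if_congr (h a ha b hb) rfl rfl

lemma adjPairs_singleton_self (x : V) : G.adjPairs {x} {x} = 0 := by simp [adjPairs]

section
variable [DecidableEq V]

lemma adjPairs_union_left (h : Disjoint R S) :
    G.adjPairs (R ∪ S) B = G.adjPairs R B + G.adjPairs S B := by
  unfold adjPairs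
  rw [Finset.sum_union h]

lemma adjPairs_union_right (h : Disjoint R S) :
    G.adjPairs B (R ∪ S) = G.adjPairs B R + G.adjPairs B S := by
  rw [adjPairs_comm, adjPairs_union_left h, adjPairs_comm, adjPairs_comm (R := S)]

lemma adjPairs_union_self (h : Disjoint R S) :
    G.adjPairs (R ∪ S) (R ∪ S) = G.adjPairs R R + G.adjPairs S S + 2 * G.adjPairs R S := by
  rw [adjPairs_union_left h, adjPairs_union_right h, adjPairs_union_right h,
    adjPairs_comm (R := S) (S := R)]
  ring

lemma adjPairs_insert_self {x : V} (h : x ∉ R) :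
    G.adjPairs (insert x R) (insert x R) = G.adjPairs R R + 2 * G.adjPairs {x} R := by
  rw [Finset.insert_eq, adjPairs_union_self (by simpa using h), adjPairs_singleton_self]
  ring

end

lemma even_adjPairs (R : Finset V) : Even (G.adjPairs R R) := by
  classical
  induction R using Finset.induction_on with
  | empty => simp [adjPairs]
  | insert x R hx ih =>
    rw [adjPairs_insert_self hx]
    exact ih.add (even_two_mul _)

lemma two_mul_potential (R : Finset V) :
    2 * G.potential R = 10 * R.card - 3 * G.adjPairs R R := by
  have := Int.two_mul_ediv_two_of_even (G.even_adjPairs R)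
  unfold potential
  linarith

lemma adjPairs_singleton_le (x : V) (R : Finset V) : G.adjPairs {x} R ≤ R.card := by
  simp only [adjPairs, Finset.sum_singleton, Finset.card_eq_sum_ones, Nat.cast_sum, Nat.cast_one]
  exact Finset.sum_le_sum fun b _ => by split_ifs <;> simp

lemma one_le_adjPairs_singleton {x b : V} (hb : b ∈ R) (h : G.Adj x b) :
    1 ≤ G.adjPairs {x} R := by
  classical
  have : G.adjPairs {x} {b} ≤ G.adjPairs {x} R := adjPairs_mono_right (by simpa using hb)
  rwa [show G.adjPairs {x} {b} = 1 by simp only [adjPairs, Finset.sum_singleton, h, if_true]]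
    at this

lemma two_le_adjPairs_singleton {x b c : V} (hb : b ∈ R) (hc : c ∈ R) (hbc : b ≠ c)
    (h : G.Adj x b) (h' : G.Adj x c) : 2 ≤ G.adjPairs {x} R := by
  classical
  have : G.adjPairs {x} {b, c} ≤ G.adjPairs {x} R :=
    adjPairs_mono_right (by simp [Finset.insert_subset_iff, hb, hc])
  rwa [show G.adjPairs {x} {b, c} = 2 by
    simp only [adjPairs, Finset.sum_singleton, Finset.sum_pair hbc, h, h', if_true]; rfl] at this

lemma adjPairs_self_le (R : Finset V) : G.adjPairs R R ≤ R.card * (R.card - 1) := by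
  classical
  induction R using Finset.induction_on with
  | empty => simp [adjPairs]
  | insert x R hx ih =>
    rw [adjPairs_insert_self hx, Finset.card_insert_of_notMem hx]
    have := G.adjPairs_singleton_le x R
    push_cast
    linarith

lemma potential_ge_six_of_card (h : 2 ≤ R.card) (h' : R.card < 4) : 6 ≤ G.potential R := by
  have h1 := G.two_mul_potential R
  have h2 := G.adjPairs_self_le R
  have : R.card = 2 ∨ R.card = 3 := by omega
  rcases this with h | h <;> rw [h] at h1 h2 <;> norm_num at h1 h2 <;> omega

open Classical in
/-- A proper colouring extends to a vertex which sees at most two colours. -/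
lemma ProperOn.extend {φ : V → Fin 3} (hφ : G.ProperOn R φ) {z : V} {k : Fin 3}
    (hk : ∀ b ∈ R, G.Adj z b → φ b ≠ k) (hz : z ∉ R) :
    G.ProperOn (insert z R) (Function.update φ z k) := by
  intro a ha b hb hab
  rw [Finset.mem_insert] at ha hb
  have hne : ∀ b ∈ R, b ≠ z := fun b hb h => hz (h ▸ hb)
  rcases ha with rfl | ha <;> rcases hb with rfl | hb
  · exact absurd hab (G.loopless.irrefl _)
  · rw [Function.update_self, Function.update_of_ne (hne b hb)]
    exact (hk b hb hab).symm
  · rw [Function.update_self, Function.update_of_ne (hne a ha)]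
    exact hk a ha hab.symm
  · rw [Function.update_of_ne (hne a ha), Function.update_of_ne (hne b hb)]
    exact hφ a ha b hb hab

lemma exists_color_avoiding_pair (i j : Fin 3) : ∃ k, i ≠ k ∧ j ≠ k := by decide +revert

lemma card_ge_two_of_not_colorableOn (h : ¬ G.ColorableOn R) : 2 ≤ R.card := by
  by_contra hc
  have h1 : R.card ≤ 1 := by omega
  refine h ⟨fun _ => 0, fun a ha b hb hab => ?_⟩
  exact absurd (Finset.card_le_one.1 h1 a ha b hb) hab.ne

/-- A minimal non-3-colourable vertex set. -/
structure CriticalOn (G : SimpleGraph V) (A : Finset V) : Prop where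
  not_colorableOn : ¬ G.ColorableOn A
  colorableOn_of_ssubset : ∀ B ⊂ A, G.ColorableOn B

/-- The conclusion of the Kostochka-Yancey theorem for all sets with fewer than `n` vertices. -/
def LowPotentialBelow (n : ℕ) : Prop :=
  ∀ (V : Type) (G : SimpleGraph V) (S : Finset V), S.card < n → ¬ G.ColorableOn S →
    ∃ W ⊆ S, ¬ G.ColorableOn W ∧ G.potential W ≤ 2

/-- The graph obtained from `G` by attaching a triangle in place of the colour classes of `φ`
on `R`. -/
def collapse (G : SimpleGraph V) (R : Finset V) (φ : V → Fin 3) : SimpleGraph (V ⊕ Fin 3) where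
  Adj
    | .inl a, .inl b => G.Adj a b
    | .inl a, .inr i => ∃ b ∈ R, φ b = i ∧ G.Adj a b
    | .inr i, .inl a => ∃ b ∈ R, φ b = i ∧ G.Adj a b
    | .inr i, .inr j => i ≠ j
  symm := ⟨by
    rintro (a | i) (b | j) h
    · exact h.symm
    · exact h
    · exact h
    · exact Ne.symm h⟩
  loopless := ⟨by
    rintro (a | i) h
    · exact G.loopless.irrefl _ h
    · exact h rfl⟩

lemma colorableOn_of_collapse {φ : V → Fin 3} (hφ : G.ProperOn R φ) [DecidableEq V]
    (h : (G.collapse R φ).ColorableOn ((A \ R).disjSum Finset.univ)) : G.ColorableOn A := by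
  obtain ⟨ψ, hψ⟩ := h
  have hin : ∀ a ∈ A, a ∉ R → Sum.inl a ∈ (A \ R).disjSum (Finset.univ : Finset (Fin 3)) := by
    intro a ha haR
    simp [ha, haR]
  have hX : ∀ i, Sum.inr i ∈ (A \ R).disjSum (Finset.univ : Finset (Fin 3)) := by simp
  refine ⟨fun a => if a ∈ R then ψ (.inr (φ a)) else ψ (.inl a), fun a ha b hb hab => ?_⟩
  by_cases haR : a ∈ R <;> by_cases hbR : b ∈ R <;> simp only [haR, hbR, if_true, if_false]
  · exact hψ _ (hX _) _ (hX _) (hφ a haR b hbR hab)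
  · exact hψ _ (hX _) _ (hin b hb hbR) ⟨a, haR, rfl, hab.symm⟩
  · exact hψ _ (hin a ha haR) _ (hX _) ⟨b, hbR, rfl, hab⟩
  · exact hψ _ (hin a ha haR) _ (hin b hb hbR) hab

open Classical in
lemma adjPairs_collapse (φ : V → Fin 3) (W : Finset V) (X : Finset (Fin 3)) :
    (G.collapse R φ).adjPairs (W.disjSum X) (W.disjSum X) =
      G.adjPairs W W + X.card * (X.card - 1) +
        2 * ∑ a ∈ W, ∑ i ∈ X, if ∃ b ∈ R, φ b = i ∧ G.Adj a b then 1 else 0 := by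
  have hX : (∑ i ∈ X, ∑ j ∈ X, if i ≠ j then (1 : ℤ) else 0) = X.card * (X.card - 1) := by
    revert X; decide
  have hc : (∑ i ∈ X, ∑ a ∈ W, if ∃ b ∈ R, φ b = i ∧ G.Adj a b then (1 : ℤ) else 0) =
      ∑ a ∈ W, ∑ i ∈ X, if ∃ b ∈ R, φ b = i ∧ G.Adj a b then (1 : ℤ) else 0 :=
    Finset.sum_comm
  have h1 : ∀ a b, (G.collapse R φ).Adj (.inl a) (.inl b) ↔ G.Adj a b := fun _ _ => Iff.rfl
  have h2 : ∀ a i, (G.collapse R φ).Adj (.inl a) (.inr i) ↔ ∃ b ∈ R, φ b = i ∧ G.Adj a b :=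
    fun _ _ => Iff.rfl
  have h3 : ∀ i a, (G.collapse R φ).Adj (.inr i) (.inl a) ↔ ∃ b ∈ R, φ b = i ∧ G.Adj a b :=
    fun _ _ => Iff.rfl
  have h4 : ∀ i j, (G.collapse R φ).Adj (.inr i) (.inr j) ↔ i ≠ j := fun _ _ => Iff.rfl
  simp only [adjPairs, Finset.sum_disjSum, Finset.sum_add_distrib, h1, h2, h3, h4]
  rw [hc, ← hX]
  ring

open Classical in
lemma sum_collapse_le (φ : V → Fin 3) (W : Finset V) (X : Finset (Fin 3)) :
    (∑ a ∈ W, ∑ i ∈ X, if ∃ b ∈ R, φ b = i ∧ G.Adj a b then (1 : ℤ) else 0) ≤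
      G.adjPairs W (R.filter fun b => φ b ∈ X) := by
  refine Finset.sum_le_sum fun a _ => ?_
  rw [← Finset.sum_fiberwise_of_maps_to (g := φ) (t := X) (by simp)]
  refine Finset.sum_le_sum fun i hi => ?_
  split_ifs with h
  · obtain ⟨b, hb, rfl, hab⟩ := h
    refine le_trans ?_ (Finset.single_le_sum (a := b) (fun c _ => ?_) ?_)
    · simp [hab]
    · split_ifs <;> simp
    · simp [hb, hi]
  · exact Finset.sum_nonneg fun c _ => by split_ifs <;> simp

open Classical in
/-- Collapsing the colour classes of a large set produces a set of smaller potential. -/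
lemma CriticalOn.exists_collapse (hA : G.CriticalOn A) (ih : LowPotentialBelow A.card)
    (hR : R ⊆ A) (hcard : 4 ≤ R.card) {φ : V → Fin 3} (hφ : G.ProperOn R φ) :
    ∃ W ⊆ A \ R, ∃ X : Finset (Fin 3), X.Nonempty ∧
      2 * G.potential (W ∪ R) ≤ 4 + 2 * G.potential R - 10 * X.card + 3 * (X.card * (X.card - 1))
        - 6 * G.adjPairs W (R.filter fun b => φ b ∉ X) := by
  have hY : ¬ (G.collapse R φ).ColorableOn ((A \ R).disjSum Finset.univ) := fun h =>
    hA.not_colorableOn (colorableOn_of_collapse hφ h)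
  have hc : ((A \ R).disjSum (Finset.univ : Finset (Fin 3))).card < A.card := by
    rw [Finset.card_disjSum, Finset.card_univ, Fintype.card_fin, Finset.card_sdiff_of_subset hR]
    have := Finset.card_le_card hR
    omega
  obtain ⟨U, hU, hUc, hUp⟩ := ih _ _ _ hc hY
  have hUe : U.toLeft.disjSum U.toRight = U := Finset.toLeft_disjSum_toRight
  have hW : U.toLeft ⊆ A \ R := by
    intro a ha
    have := hU (Finset.mem_toLeft.1 ha)
    simpa using this
  refine ⟨U.toLeft, hW, U.toRight, ?_, ?_⟩
  · by_contra hX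
    rw [Finset.not_nonempty_iff_eq_empty] at hX
    obtain ⟨b, hb⟩ : R.Nonempty := Finset.card_pos.1 (by omega)
    obtain ⟨ψ, hψ⟩ := hA.colorableOn_of_ssubset (A \ R)
      (Finset.ssubset_iff_subset_ne.2 ⟨Finset.sdiff_subset, fun h => by
        have := hR hb
        rw [← h] at this
        simp [hb] at this⟩)
    refine hUc ⟨Sum.elim ψ fun _ => 0, ?_⟩
    rw [← hUe, hX]
    rintro (a | i) ha (b | j) hb hab
    · simp only [Finset.inl_mem_disjSum] at ha hb
      exact hψ a (hW ha) b (hW hb) hab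
    all_goals simp at ha hb
  · have h1 := (G.collapse R φ).two_mul_potential U
    rw [← hUe, adjPairs_collapse, Finset.card_disjSum, hUe] at h1
    have hd : Disjoint U.toLeft R :=
      Finset.disjoint_left.2 fun a ha => (Finset.mem_sdiff.1 (hW ha)).2
    have h2 := G.two_mul_potential (U.toLeft ∪ R)
    rw [adjPairs_union_self hd, Finset.card_union_of_disjoint hd] at h2
    have h3 := G.two_mul_potential R
    have h4 := sum_collapse_le (G := G) (R := R) φ U.toLeft U.toRight
    have h5 : G.adjPairs U.toLeft R = G.adjPairs U.toLeft (R.filter fun b => φ b ∈ U.toRight) +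
        G.adjPairs U.toLeft (R.filter fun b => φ b ∉ U.toRight) := by
      rw [← adjPairs_union_right (Finset.disjoint_filter_filter_not _ _ _),
        Finset.filter_union_filter_not_eq]
    push_cast at h1 h2
    linarith

lemma two_mul_clique_potential_ge {X : Finset (Fin 3)} (hX : X.Nonempty) :
    (10 : ℤ) ≤ 10 * X.card - 3 * (X.card * (X.card - 1)) ∧
    (X.card ≠ 1 → (12 : ℤ) ≤ 10 * X.card - 3 * (X.card * (X.card - 1))) := by
  revert X; decide

open Classical in
/-- Proper subsets with at least two vertices have potential at least `6`. -/
lemma CriticalOn.six_le_potential (hA : G.CriticalOn A) (ih : LowPotentialBelow A.card)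
    (hp : 3 ≤ G.potential A) (hR : R ⊂ A) (hcard : 2 ≤ R.card) : 6 ≤ G.potential R := by
  by_contra hlt
  obtain ⟨T, hT, hmin⟩ := Finset.exists_min_image
    (A.powerset.filter fun R => R ⊂ A ∧ 2 ≤ R.card) G.potential
    ⟨R, by simp [hR, hcard, hR.subset]⟩
  simp only [Finset.mem_filter, Finset.mem_powerset, and_imp] at hT hmin
  obtain ⟨hTA, hTs, hTc⟩ := hT
  have hT5 := hmin R hR.subset hR hcard
  have hT4 : 4 ≤ T.card := by
    by_contra h
    have := G.potential_ge_six_of_card hTc (by omega)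
    omega
  obtain ⟨φ, hφ⟩ := hA.colorableOn_of_ssubset T hTs
  obtain ⟨W, hW, X, hX, hWX⟩ := hA.exists_collapse ih hTA hT4 hφ
  have h1 := (two_mul_clique_potential_ge hX).1
  have h2 : 0 ≤ G.adjPairs W (T.filter fun b => φ b ∉ X) := adjPairs_nonneg
  have hsub : W ∪ T ⊆ A := Finset.union_subset (hW.trans Finset.sdiff_subset) hTA
  have hlow : G.potential (W ∪ T) ≤ G.potential T - 3 := by linarith
  rcases hsub.eq_or_ssubset with h | h
  · rw [h] at hlow
    omega
  · have := hmin _ hsub h (hTc.trans (Finset.card_le_card Finset.subset_union_right))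
    omega

open Classical in
lemma CriticalOn.exists_boundary (hA : G.CriticalOn A) (hR : R ⊂ A) (hcard : 2 ≤ R.card) :
    ∃ u ∈ R, ∃ v ∈ R, u ≠ v ∧ (∃ a ∈ A \ R, G.Adj a u) ∧ ∃ a ∈ A \ R, G.Adj a v := by
  by_contra hcon
  push Not at hcon
  obtain ⟨u, hu, huniq⟩ : ∃ u ∈ R, ∀ v ∈ R, ∀ a ∈ A \ R, G.Adj a v → v = u := by
    by_cases h : ∃ u ∈ R, ∃ a ∈ A \ R, G.Adj a u
    · obtain ⟨u, hu, ha⟩ := h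
      refine ⟨u, hu, fun v hv a ha' hav => ?_⟩
      by_contra hvu
      exact hcon u hu v hv (Ne.symm hvu) ha a ha' hav
    · push Not at h
      obtain ⟨u, hu⟩ : R.Nonempty := Finset.card_pos.1 (by omega)
      exact ⟨u, hu, fun v hv a ha hav => absurd hav (h v hv a ha)⟩
  obtain ⟨φ, hφ⟩ := hA.colorableOn_of_ssubset R hR
  obtain ⟨w, hw, hwu⟩ := Finset.exists_mem_ne (s := R) (by omega) u
  obtain ⟨ψ, hψ⟩ := hA.colorableOn_of_ssubset (insert u (A \ R)) (by
    refine Finset.ssubset_iff_subset_ne.2 ⟨Finset.insert_subset (hR.subset hu)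
      Finset.sdiff_subset, fun h => ?_⟩
    have := hR.subset hw
    rw [← h] at this
    simp [hwu, hw] at this)
  have hcross : ∀ a ∈ A, a ∉ R → ∀ b ∈ R, G.Adj a b →
      Equiv.swap (ψ u) (φ u) (ψ a) ≠ φ b := by
    intro a ha haR b hb hab
    obtain rfl := huniq b hb a (by simp [ha, haR]) hab
    have h := hψ a (by simp [ha, haR]) b (by simp) hab
    exact fun h' => h (Equiv.injective (Equiv.swap (ψ b) (φ b))
      (h'.trans (Equiv.swap_apply_left _ _).symm))
  refine hA.not_colorableOn ⟨fun a => if a ∈ R then φ a else Equiv.swap (ψ u) (φ u) (ψ a),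
    fun a ha b hb hab => ?_⟩
  by_cases haR : a ∈ R <;> by_cases hbR : b ∈ R <;> simp only [haR, hbR, if_true, if_false]
  · exact hφ a haR b hbR hab
  · exact (hcross b hb hbR a haR hab.symm).symm
  · exact hcross a ha haR b hbR hab
  · rw [(Equiv.injective _).ne_iff]
    exact hψ a (by simp [ha, haR]) b (by simp [hb, hbR]) hab

open Classical in
lemma adjPairs_sup_edge_le (u v : V) (R : Finset V) :
    (G ⊔ edge u v).adjPairs R R ≤ G.adjPairs R R + 2 := by
  have h : ∀ x y : V, (∑ a ∈ R, ∑ b ∈ R, if a = x ∧ b = y then (1 : ℤ) else 0) ≤ 1 := by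
    intro x y
    simp only [ite_and]
    rw [Finset.sum_congr rfl fun a _ => Finset.sum_ite_irrel (a = x) R _ _]
    simp only [Finset.sum_ite_eq', Finset.sum_const_zero]
    split_ifs <;> simp
  have h1 := h u v
  have h2 := h v u
  have : (G ⊔ edge u v).adjPairs R R ≤ G.adjPairs R R +
      ((∑ a ∈ R, ∑ b ∈ R, if a = u ∧ b = v then (1 : ℤ) else 0) +
        ∑ a ∈ R, ∑ b ∈ R, if a = v ∧ b = u then (1 : ℤ) else 0) := by
    unfold adjPairs
    simp only [← Finset.sum_add_distrib]
    refine Finset.sum_le_sum fun a _ => Finset.sum_le_sum fun b _ => ?_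
    have : (G ⊔ edge u v).Adj a b → G.Adj a b ∨ (a = u ∧ b = v) ∨ (a = v ∧ b = u) := by
      rw [sup_adj, edge_adj]
      tauto
    by_cases h1 : (G ⊔ edge u v).Adj a b
    · rw [if_pos h1]
      rcases this h1 with h2 | h2 | h2
      · rw [if_pos h2]
        split_ifs <;> simp
      · rw [if_pos h2]
        split_ifs <;> simp
      · rw [if_pos h2]
        split_ifs <;> simp
    · rw [if_neg h1]
      split_ifs <;> simp
  linarith

open Classical in
/-- If `G ⊔ uv` has a non-3-colourable set inside a proper subset of `A`, that set is small. -/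
lemma CriticalOn.colorableOn_sup_edge (hA : G.CriticalOn A) (ih : LowPotentialBelow A.card)
    (hp : 3 ≤ G.potential A) (hR : R ⊂ A) (u v : V) : (G ⊔ edge u v).ColorableOn R := by
  by_contra hH
  obtain ⟨U, hU, hUc, hUp⟩ := ih _ _ _ (Finset.card_lt_card hR) hH
  have h1 := hA.six_le_potential ih hp (hU.trans_ssubset hR) (card_ge_two_of_not_colorableOn hUc)
  have h2 := G.two_mul_potential U
  have h3 := (G ⊔ edge u v).two_mul_potential U
  have h4 := G.adjPairs_sup_edge_le u v U
  omega

open Classical in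
/-- Proper subsets with at least four vertices have potential at least `7`. -/
lemma CriticalOn.seven_le_potential (hA : G.CriticalOn A) (ih : LowPotentialBelow A.card)
    (hp : 3 ≤ G.potential A) (hR : R ⊂ A) (hcard : 4 ≤ R.card) : 7 ≤ G.potential R := by
  by_contra hlt
  obtain ⟨u, hu, v, hv, huv, ⟨a, ha, hau⟩, b, hb, hbv⟩ := hA.exists_boundary hR (by omega)
  obtain ⟨φ, hφ'⟩ := hA.colorableOn_sup_edge ih hp hR u v
  have hφ : G.ProperOn R φ := fun a ha b hb hab => hφ' a ha b hb (Or.inl hab)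
  have hφuv : φ u ≠ φ v := hφ' u hu v hv (by simp [edge_adj, huv])
  obtain ⟨W, hW, X, hX, hWX⟩ := hA.exists_collapse ih hR.subset hcard hφ
  have hsub : W ∪ R ⊆ A := Finset.union_subset (hW.trans Finset.sdiff_subset) hR.subset
  have hc : 2 ≤ (W ∪ R).card :=
    le_trans (by omega) (Finset.card_le_card (Finset.subset_union_right (s₁ := W) (s₂ := R)))
  have h2 : 0 ≤ G.adjPairs W (R.filter fun b => φ b ∉ X) := adjPairs_nonneg
  have hX2 := two_mul_clique_potential_ge hX
  have heq : W ∪ R = A := by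
    rcases hsub.eq_or_ssubset with h | h
    · exact h
    · have := hA.six_le_potential ih hp h hc
      linarith [hX2.1]
  by_cases hX1 : X.card = 1
  · obtain ⟨i, rfl⟩ := Finset.card_eq_one.1 hX1
    have hmem : ∀ a ∈ A \ R, a ∈ W := by
      intro a ha
      rw [Finset.mem_sdiff, ← heq, Finset.mem_union] at ha
      tauto
    have : ∃ a ∈ W, ∃ b ∈ R, φ b ≠ i ∧ G.Adj a b := by
      by_cases hi : φ u = i
      · exact ⟨b, hmem b hb, v, hv, fun h => hφuv (hi.trans h.symm), hbv⟩
      · exact ⟨a, hmem a ha, u, hu, hi, hau⟩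
    obtain ⟨a, haW, b, hbR, hbi, hab⟩ := this
    have h3 : 1 ≤ G.adjPairs {a} (R.filter fun b => φ b ∉ ({i} : Finset (Fin 3))) :=
      one_le_adjPairs_singleton (by simp [hbR, hbi]) hab
    have h4 : G.adjPairs {a} (R.filter fun b => φ b ∉ ({i} : Finset (Fin 3))) ≤
        G.adjPairs W (R.filter fun b => φ b ∉ ({i} : Finset (Fin 3))) :=
      adjPairs_mono_left (by simpa using haW)
    rw [heq] at hWX
    linarith [hX2.1]
  · rw [heq] at hWX
    linarith [hX2.2 hX1]

open Classical in
lemma adjPairs_singleton_eq_card (x : V) (R : Finset V) :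
    G.adjPairs {x} R = (R.filter (G.Adj x)).card := by
  simp [adjPairs]

open Classical in
/-- Vertices of a critical set have at least three neighbours in it. -/
lemma CriticalOn.three_le_degree (hA : G.CriticalOn A) {x : V} (hx : x ∈ A) :
    3 ≤ (A.filter (G.Adj x)).card := by
  by_contra hlt
  obtain ⟨φ, hφ⟩ := hA.colorableOn_of_ssubset (A.erase x) (Finset.erase_ssubset hx)
  obtain ⟨k, hk⟩ : ∃ k, k ∉ (A.filter (G.Adj x)).image φ := by
    by_contra hcon
    push Not at hcon
    have h1 : ((A.filter (G.Adj x)).image φ).card = 3 := by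
      rw [Finset.eq_univ_of_forall hcon]; rfl
    have := Finset.card_image_le (s := A.filter (G.Adj x)) (f := φ)
    omega
  have := hφ.extend (z := x) (k := k) (fun b hb hab h => hk (Finset.mem_image.2
    ⟨b, Finset.mem_filter.2 ⟨Finset.mem_of_mem_erase hb, hab⟩, h⟩)) (Finset.notMem_erase x A)
  rw [Finset.insert_erase hx] at this
  exact hA.not_colorableOn ⟨_, this⟩

open Classical in
/-- A critical set of potential at least `3` contains no `K₄` minus an edge. -/
lemma CriticalOn.no_diamond (hA : G.CriticalOn A) (ih : LowPotentialBelow A.card)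
    (hp : 3 ≤ G.potential A) {p q r s : V} (hpA : p ∈ A) (hqA : q ∈ A) (hrA : r ∈ A) (hsA : s ∈ A)
    (hpq : G.Adj p q) (hpr : G.Adj p r) (hps : G.Adj p s) (hqr : G.Adj q r) (hqs : G.Adj q s)
    (hrs : r ≠ s) : False := by
  have hsub : ({p, q, r, s} : Finset V) ⊆ A := by
    simp [Finset.insert_subset_iff, hpA, hqA, hrA, hsA]
  have h1 : p ∉ ({q, r, s} : Finset V) := by simp [hpq.ne, hpr.ne, hps.ne]
  have h2 : q ∉ ({r, s} : Finset V) := by simp [hqr.ne, hqs.ne]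
  have h3 : r ∉ ({s} : Finset V) := by simp [hrs]
  have hc : ({p, q, r, s} : Finset V).card = 4 := by
    rw [Finset.card_insert_of_notMem h1, Finset.card_insert_of_notMem h2, Finset.card_pair hrs]
  have e1 : G.adjPairs {p} {q, r, s} = 3 := by
    rw [adjPairs_singleton_eq_card, Finset.filter_true_of_mem (by simp [hpq, hpr, hps]),
      Finset.card_insert_of_notMem h2, Finset.card_pair hrs]
    rfl
  have e2 : G.adjPairs {q} {r, s} = 2 := by
    rw [adjPairs_singleton_eq_card, Finset.filter_true_of_mem (by simp [hqr, hqs]),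
      Finset.card_pair hrs]
    rfl
  have e3 : 0 ≤ G.adjPairs {r} {s} := adjPairs_nonneg
  have hpot := G.two_mul_potential {p, q, r, s}
  rw [adjPairs_insert_self h1, adjPairs_insert_self h2, adjPairs_insert_self h3, e1, e2, hc,
    adjPairs_singleton_self] at hpot
  push_cast at hpot
  rcases hsub.eq_or_ssubset with h | h
  · by_cases hrs' : G.Adj r s
    · have := one_le_adjPairs_singleton (Finset.mem_singleton_self s) hrs'
      rw [h] at hpot
      omega
    · refine hA.not_colorableOn ⟨fun v => if v = p then 0 else if v = q then 1 else 2, ?_⟩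
      rw [← h]
      have hrs'' : ¬ G.Adj s r := fun h => hrs' h.symm
      intro a ha b hb hab
      simp only [Finset.mem_insert, Finset.mem_singleton] at ha hb
      rcases ha with rfl | rfl | rfl | rfl <;> rcases hb with rfl | rfl | rfl | rfl <;>
        simp_all [hpq.ne, hpr.ne, hps.ne, hqr.ne, hqs.ne, hpq.ne', hpr.ne', hps.ne', hqr.ne',
          hqs.ne']
  · have := hA.six_le_potential ih hp h (by omega)
    omega

lemma exists_third_of_card_eq_three {s : Finset V} (h : s.card = 3) {y z : V}
    (hy : y ∈ s) (hz : z ∈ s) (hyz : y ≠ z) :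
    ∃ a ∈ s, a ≠ y ∧ a ≠ z ∧ ∀ b ∈ s, b = y ∨ b = z ∨ b = a := by
  classical
  have h1 : ((s.erase y).erase z).card = 1 := by
    rw [Finset.card_erase_of_mem (by simp [hz, hyz.symm]), Finset.card_erase_of_mem hy, h]
  obtain ⟨a, ha⟩ := Finset.card_eq_one.1 h1
  have hmem : a ∈ (s.erase y).erase z := by simp [ha]
  simp only [Finset.mem_erase] at hmem
  refine ⟨a, hmem.2.2, hmem.2.1, hmem.1, fun b hb => ?_⟩
  by_contra hcon
  push Not at hcon
  have : b ∈ (s.erase y).erase z := by simp [hb, hcon.1, hcon.2.1]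
  rw [ha, Finset.mem_singleton] at this
  exact hcon.2.2 this

lemma exists_colors_of_ne (c i j : Fin 3) (h : i ≠ j) :
    ∃ k l, c ≠ k ∧ i ≠ k ∧ c ≠ l ∧ j ≠ l ∧ k ≠ l := by
  decide +revert

open Classical in
/-- A triangle contains at most one vertex of degree three. -/
lemma CriticalOn.no_triangle_with_two_cubic (hA : G.CriticalOn A)
    (ih : LowPotentialBelow A.card) (hp : 3 ≤ G.potential A) {x y z : V}
    (hxA : x ∈ A) (hyA : y ∈ A) (hzA : z ∈ A)
    (hxy : G.Adj x y) (hxz : G.Adj x z) (hyz : G.Adj y z)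
    (hx : (A.filter (G.Adj x)).card = 3) (hy : (A.filter (G.Adj y)).card = 3) : False := by
  obtain ⟨a, ha, hay, haz, haN⟩ := exists_third_of_card_eq_three hx (y := y) (z := z)
    (by simp [hyA, hxy]) (by simp [hzA, hxz]) hyz.ne
  obtain ⟨b, hb, hbx, hbz, hbN⟩ := exists_third_of_card_eq_three hy (y := x) (z := z)
    (by simp [hxA, hxy.symm]) (by simp [hzA, hyz]) hxz.ne
  simp only [Finset.mem_filter, and_imp] at ha hb haN hbN
  have hab : a ≠ b := by
    rintro rfl
    exact hA.no_diamond ih hp hxA hyA hzA ha.1 hxy hxz ha.2 hyz hb.2 haz.symm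
  have hss : (A.erase x).erase y ⊂ A :=
    (Finset.erase_subset _ _).trans_ssubset (Finset.erase_ssubset hxA)
  obtain ⟨φ, hφ'⟩ := hA.colorableOn_sup_edge ih hp hss a b
  have hφ : G.ProperOn ((A.erase x).erase y) φ :=
    fun a ha b hb hab => hφ' a ha b hb (Or.inl hab)
  have hφab : φ a ≠ φ b := hφ' a (by simp [ha.1, ha.2.ne', hay]) b
    (by simp [hb.1, hb.2.ne', hbx]) (by simp [edge_adj, hab])
  obtain ⟨k, l, hck, hak, hcl, hbl, hkl⟩ := exists_colors_of_ne (φ z) _ _ hφab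
  have hext := hφ.extend (z := y) (k := l) (fun w hw hyw => by
    simp only [Finset.mem_erase] at hw
    rcases hbN w hw.2.2 hyw with rfl | rfl | rfl
    · exact absurd rfl hw.2.1
    · exact hcl
    · exact hbl) (by simp)
  rw [Finset.insert_erase (by simp [hyA, hxy.ne'])] at hext
  have hextend := hext.extend (z := x) (k := k) (fun w hw hxw => by
    simp only [Finset.mem_erase] at hw
    rcases haN w hw.2 hxw with rfl | rfl | rfl
    · rwa [Function.update_self, ne_comm]
    · rwa [Function.update_of_ne hyz.ne']
    · rwa [Function.update_of_ne hay]) (by simp)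
  rw [Finset.insert_erase hxA] at hextend
  exact hA.not_colorableOn ⟨_, hextend⟩

/-- The graph in which the vertex `u` is made adjacent to all neighbours of `v`. -/
def absorb (G : SimpleGraph V) (u v : V) : SimpleGraph V where
  Adj a b := a ≠ b ∧ (G.Adj a b ∨ (a = u ∧ G.Adj v b) ∨ (b = u ∧ G.Adj v a))
  symm := ⟨fun a b h => ⟨h.1.symm, by rcases h.2 with h | h | h <;> simp [h, h.symm]⟩⟩
  loopless := ⟨fun a h => h.1 rfl⟩

open Classical in
lemma adjPairs_absorb_le {u v : V} {W : Finset V} (hu : u ∈ W) (hv : v ∉ W) :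
    (G.absorb u v).adjPairs W W ≤ G.adjPairs (insert v W) (insert v W) := by
  have h1 : (G.absorb u v).adjPairs (W.erase u) (W.erase u) =
      G.adjPairs (W.erase u) (W.erase u) := by
    refine adjPairs_congr fun a ha b hb => ?_
    simp only [Finset.mem_erase] at ha hb
    simp only [absorb, ha.1, hb.1, false_and, or_false]
    exact ⟨fun h => h.2, fun h => ⟨h.ne, h⟩⟩
  have h2 : (G.absorb u v).adjPairs {u} (W.erase u) ≤
      G.adjPairs {u} (W.erase u) + G.adjPairs {v} (W.erase u) := by
    simp only [adjPairs, Finset.sum_singleton, ← Finset.sum_add_distrib]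
    refine Finset.sum_le_sum fun b hb => ?_
    have hbu : b ≠ u := Finset.ne_of_mem_erase hb
    by_cases h : (G.absorb u v).Adj u b
    · have : G.Adj u b ∨ G.Adj v b := by
        simpa [absorb, hbu] using h.2
      rw [if_pos h]
      rcases this with h | h <;> rw [if_pos h] <;> split_ifs <;> simp
    · rw [if_neg h]
      split_ifs <;> simp
  have h3 : G.adjPairs {v} (W.erase u) ≤ G.adjPairs {v} W :=
    adjPairs_mono_right (Finset.erase_subset _ _)
  rw [adjPairs_insert_self hv]
  have e1 := (G.absorb u v).adjPairs_insert_self (Finset.notMem_erase u W)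
  have e2 := G.adjPairs_insert_self (Finset.notMem_erase u W)
  rw [Finset.insert_erase hu] at e1 e2
  omega

open Classical in
/-- If two vertices of degree three are adjacent then each of them lies in a triangle. -/
lemma CriticalOn.exists_triangle_of_adj_cubic (hA : G.CriticalOn A)
    (ih : LowPotentialBelow A.card) (hp : 3 ≤ G.potential A) {x y u v : V}
    (hxA : x ∈ A) (hyA : y ∈ A) (huA : u ∈ A) (hvA : v ∈ A) (huv : u ≠ v)
    (hyu : u ≠ y) (hyv : v ≠ y) (hxy : G.Adj x y) (hxu : G.Adj x u) (hxv : G.Adj x v)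
    (hx : (A.filter (G.Adj x)).card = 3) (hy : (A.filter (G.Adj y)).card = 3) :
    G.Adj u v := by
  by_contra hnuv
  have hnyu : ¬ G.Adj y u := fun h =>
    hA.no_triangle_with_two_cubic ih hp hxA hyA huA hxy hxu h hx hy
  have hnyv : ¬ G.Adj y v := fun h =>
    hA.no_triangle_with_two_cubic ih hp hxA hyA hvA hxy hxv h hx hy
  have hxN : ∀ w ∈ A, G.Adj x w → w = u ∨ w = v ∨ w = y := by
    obtain ⟨y', -, -, -, hN⟩ := exists_third_of_card_eq_three hx (y := u) (z := v)
      (by simp [huA, hxu]) (by simp [hvA, hxv]) huv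
    intro w hw hxw
    have h1 := hN w (by simp [hw, hxw])
    have h2 := hN y (by simp [hyA, hxy])
    grind
  have hS : ((A.erase x).erase y).erase v ⊂ A :=
    (Finset.erase_subset _ _).trans_ssubset
      ((Finset.erase_subset _ _).trans_ssubset (Finset.erase_ssubset hxA))
  have hnc : ¬ (G.absorb u v).ColorableOn (((A.erase x).erase y).erase v) := by
    rintro ⟨ψ, hψ⟩
    set φ := Function.update ψ v (ψ u) with hφdef
    have hφ : G.ProperOn ((A.erase x).erase y) φ := by
      have hv' : v ∈ (A.erase x).erase y := by simp [hvA, hyv, hxv.ne']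
      rw [← Finset.insert_erase hv']
      refine ProperOn.extend (fun a ha b hb hab => hψ a ha b hb ⟨hab.ne, Or.inl hab⟩)
        (fun b hb hvb => ?_) (by simp)
      have hbu : b ≠ u := by
        rintro rfl
        exact hnuv hvb.symm
      exact hψ b hb u (by simp [huA, huv, hyu, hxu.ne']) ⟨hbu, Or.inr (Or.inr ⟨rfl, hvb⟩)⟩
    have hφuv : φ u = φ v := by
      rw [hφdef, Function.update_self, Function.update_of_ne huv]
    obtain ⟨k, hk⟩ : ∃ k, ∀ b ∈ (A.erase x).erase y, G.Adj y b → φ b ≠ k := by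
      obtain ⟨x', hx', hx'x⟩ := Finset.exists_mem_ne (s := A.filter (G.Adj y)) (by omega) x
      obtain ⟨z, -, -, -, hN⟩ := exists_third_of_card_eq_three hy (y := x) (z := x')
        (by simp [hxA, hxy.symm]) hx' hx'x.symm
      obtain ⟨k, hk1, hk2⟩ := exists_color_avoiding_pair (φ x') (φ z)
      refine ⟨k, fun b hb hyb => ?_⟩
      simp only [Finset.mem_erase] at hb
      rcases hN b (by simp [hb.2.2, hyb]) with rfl | rfl | rfl
      · exact absurd rfl hb.2.1
      · exact hk1
      · exact hk2
    have hext := hφ.extend hk (by simp)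
    rw [Finset.insert_erase (by simp [hyA, hxy.ne'])] at hext
    obtain ⟨l, hl1, hl2⟩ := exists_color_avoiding_pair (φ u) k
    have hextend := hext.extend (z := x) (k := l) (fun w hw hxw => by
      simp only [Finset.mem_erase] at hw
      rcases hxN w hw.2 hxw with rfl | rfl | rfl
      · rwa [Function.update_of_ne hyu]
      · rwa [Function.update_of_ne hyv, ← hφuv]
      · rwa [Function.update_self]) (by simp)
    rw [Finset.insert_erase hxA] at hextend
    exact hA.not_colorableOn ⟨_, hextend⟩
  obtain ⟨W, hW, hWc, hWp⟩ := ih _ _ _ (Finset.card_lt_card hS) hnc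
  have hW2 := card_ge_two_of_not_colorableOn hWc
  have hWA := hW.trans_ssubset hS
  have hvW : v ∉ W := fun h => by simpa using hW h
  have hxW : x ∉ W := fun h => by simpa using hW h
  have hyW : y ∉ W := fun h => by simpa using hW h
  have huW : u ∈ W := by
    by_contra huW
    obtain ⟨ψ, hψ⟩ := hA.colorableOn_of_ssubset W hWA
    refine hWc ⟨ψ, fun a ha b hb hab => hψ a ha b hb ?_⟩
    rcases hab.2 with h | h | h
    · exact h
    · exact absurd (h.1 ▸ ha) huW
    · exact absurd (h.1 ▸ hb) huW
  have hxW' : x ∉ insert v W := by simp [hxv.ne, hxW]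
  have hsub : insert x (insert v W) ⊂ A := by
    refine Finset.ssubset_iff_subset_ne.2 ⟨?_, fun h => ?_⟩
    · simp [Finset.insert_subset_iff, hxA, hvA, hWA.subset]
    · rw [← h] at hyA
      simp [hxy.ne', hyv.symm, hyW] at hyA
  have hc1 := Finset.card_insert_of_notMem hxW'
  have hc2 := Finset.card_insert_of_notMem hvW
  have h7 := hA.seven_le_potential ih hp hsub (by omega)
  have p1 := G.two_mul_potential (insert x (insert v W))
  have p2 := (G.absorb u v).two_mul_potential W
  rw [adjPairs_insert_self hxW', hc1, hc2] at p1
  have h2 := two_le_adjPairs_singleton (G := G) (R := insert v W) (by simp [huW])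
    (Finset.mem_insert_self v W) huv hxu hxv
  have h3 := adjPairs_absorb_le (G := G) huW hvW
  push_cast at p1
  omega

open Classical in
/-- A vertex of degree three has at most one neighbour of degree three. -/
lemma CriticalOn.two_le_card_large_neighbors (hA : G.CriticalOn A)
    (ih : LowPotentialBelow A.card) (hp : 3 ≤ G.potential A) {x : V} (hxA : x ∈ A)
    (hx : (A.filter (G.Adj x)).card = 3) :
    2 ≤ (A.filter fun w => G.Adj x w ∧ (A.filter (G.Adj w)).card ≠ 3).card := by
  by_contra hlt
  have hsplit := Finset.card_filter_add_card_filter_not (s := A.filter (G.Adj x))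
    (fun w => (A.filter (G.Adj w)).card ≠ 3)
  rw [Finset.filter_filter, Finset.filter_filter, hx] at hsplit
  obtain ⟨y, hy, y', hy', hyy'⟩ := Finset.one_lt_card.1
    (show 1 < (A.filter fun w => G.Adj x w ∧ ¬ (A.filter (G.Adj w)).card ≠ 3).card by omega)
  simp only [Finset.mem_filter, not_not] at hy hy'
  obtain ⟨v, hv, hvy, hvy', -⟩ := exists_third_of_card_eq_three hx (y := y) (z := y')
    (by simp [hy]) (by simp [hy']) hyy'
  rw [Finset.mem_filter] at hv
  have h := hA.exists_triangle_of_adj_cubic ih hp hxA hy.1 hy'.1 hv.1 hvy'.symm hyy'.symm hvy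
    hy.2.1 hy'.2.1 hv.2 hx hy.2.2
  exact hA.no_triangle_with_two_cubic ih hp hxA hy'.1 hv.1 hy'.2.1 hv.2 h hx hy'.2.2

open Classical in
/-- The discharging argument: an average degree below `10/3` is impossible. -/
lemma CriticalOn.potential_le_two (hA : G.CriticalOn A) (ih : LowPotentialBelow A.card) :
    G.potential A ≤ 2 := by
  by_contra hlt
  have hp : 3 ≤ G.potential A := by omega
  set d : V → ℕ := fun x => (A.filter (G.Adj x)).card with hd
  have hpairs : G.adjPairs A A = ∑ x ∈ A, (d x : ℤ) :=
    Finset.sum_congr rfl fun x _ => by simp [hd]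
  have hbig : ∀ x ∈ A, (if d x = 3 then (2 : ℤ) else 0) ≤
      ∑ w ∈ A, if d x = 3 ∧ G.Adj x w ∧ d w ≠ 3 then 1 else 0 := by
    intro x hx
    split_ifs with h
    · simp only [h, true_and, Finset.sum_boole]
      exact_mod_cast hA.two_le_card_large_neighbors ih hp hx h
    · simp [h]
  have hsmall : ∀ w ∈ A, (∑ x ∈ A, if d x = 3 ∧ G.Adj x w ∧ d w ≠ 3 then (1 : ℤ) else 0) ≤
      6 * d w - 20 + if d w = 3 then 2 else 0 := by
    intro w hw
    by_cases h : d w = 3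
    · simp [h]
    · have h3 : 3 ≤ d w := hA.three_le_degree hw
      have : (∑ x ∈ A, if d x = 3 ∧ G.Adj x w ∧ d w ≠ 3 then (1 : ℤ) else 0) ≤ d w := by
        rw [Finset.sum_boole]
        exact_mod_cast Finset.card_le_card fun x => by
          simp only [Finset.mem_filter]
          exact fun hx => ⟨hx.1, hx.2.2.1.symm⟩
      rw [if_neg h]
      omega
  have h1 := Finset.sum_le_sum hbig
  have h2 := Finset.sum_le_sum hsmall
  rw [Finset.sum_comm] at h1
  simp only [Finset.sum_add_distrib, Finset.sum_sub_distrib, ← Finset.mul_sum,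
    Finset.sum_const, nsmul_eq_mul, ← hpairs] at h2
  have h3 := G.two_mul_potential A
  linarith

lemma lowPotentialBelow (n : ℕ) : LowPotentialBelow n := by
  classical
  induction n with
  | zero => exact fun _ _ _ h => absurd h (Nat.not_lt_zero _)
  | succ n ih =>
    intro V G S hS hSc
    by_cases h : ∃ B ⊂ S, ¬ G.ColorableOn B
    · obtain ⟨B, hB, hBc⟩ := h
      obtain ⟨W, hW, hWc⟩ := ih V G B (by have := Finset.card_lt_card hB; omega) hBc
      exact ⟨W, hW.trans hB.subset, hWc⟩
    · push Not at h
      have hcrit : G.CriticalOn S := ⟨hSc, h⟩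
      refine ⟨S, subset_rfl, hSc, hcrit.potential_le_two fun W H T hT => ih W H T ?_⟩
      omega

/-- **Kostochka-Yancey.** A critical 4-chromatic graph with `n` vertices and `e` edges satisfies
`5 n - 3 e ≤ 2`. -/
theorem CriticalOn.kostochka_yancey (hA : G.CriticalOn A) : G.potential A ≤ 2 :=
  hA.potential_le_two (lowPotentialBelow _)

end SimpleGraph

open Classical in
/-- The mod 2 divergence at the vertex `v` of a chain `c` on edges `e` with ends `s e`, `t e`. -/
noncomputable def chainDiv {V E : Type} [Fintype E] (s t : E → V) (c : E → ZMod 2) (v : V) :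
    ZMod 2 :=
  ∑ e, c e * ((if s e = v then 1 else 0) + if t e = v then 1 else 0)

/-- The multigraph with edge ends `s, t` and the multigraph with edge ends `l, r` are (algebraic)
duals of each other: the cycles of the former are the cuts of the latter. -/
def IsDualPair {V E F : Type} [Fintype E] (s t : E → V) (l r : E → F) : Prop :=
  ∀ c : E → ZMod 2, (∀ v, chainDiv s t c v = 0) ↔ ∃ a : F → ZMod 2, ∀ e, c e = a (l e) + a (r e)

section Chains

variable {V W E F : Type} [Fintype E] {s t : E → V} {l r : E → F}

lemma chainDiv_add (c d : E → ZMod 2) (v : V) :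
    chainDiv s t (c + d) v = chainDiv s t c v + chainDiv s t d v := by
  simp only [chainDiv, Pi.add_apply, add_mul, Finset.sum_add_distrib]

lemma chainDiv_sum_smul {ι : Type} (S : Finset ι) (k : ι → ZMod 2) (d : ι → E → ZMod 2) (v : V) :
    chainDiv s t (fun e => ∑ i ∈ S, k i * d i e) v = ∑ i ∈ S, k i * chainDiv s t (d i) v := by
  simp only [chainDiv, Finset.sum_mul, Finset.mul_sum]
  rw [Finset.sum_comm]
  simp only [mul_assoc]

open Classical in
lemma chainDiv_single (e : E) (v : V) :
    chainDiv s t (Pi.single e 1) v = (if s e = v then 1 else 0) + if t e = v then 1 else 0 := by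
  unfold chainDiv
  rw [Finset.sum_eq_single e]
  · simp
  · intro b _ hb
    simp [hb]
  · simp

lemma chainDiv_comp_injective {ι : V → W} (hι : Function.Injective ι) (c : E → ZMod 2) (v : V) :
    chainDiv (ι ∘ s) (ι ∘ t) c (ι v) = chainDiv s t c v := by
  classical
  simp [chainDiv, hι.eq_iff]

lemma IsDualPair.of_comp_injective {ι : V → W} (hι : Function.Injective ι)
    (h : IsDualPair (ι ∘ s) (ι ∘ t) l r) : IsDualPair s t l r := by
  intro c
  rw [← h c]
  refine ⟨fun hc w => ?_, fun hc v => ?_⟩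
  · by_cases hw : ∃ v, ι v = w
    · obtain ⟨v, rfl⟩ := hw
      rw [chainDiv_comp_injective hι, hc]
    · push Not at hw
      simp [chainDiv, hw]
  · rw [← chainDiv_comp_injective hι, hc]

lemma sum_extend_zero {E' : Type} [Fintype E'] {g : E' → E} (hg : Function.Injective g)
    (c : E' → ZMod 2) (k : E → ZMod 2) :
    ∑ e, Function.extend g c 0 e * k e = ∑ e', c e' * k (g e') := by
  classical
  rw [← Finset.sum_subset (Finset.subset_univ (Finset.univ.image g)),
    Finset.sum_image hg.injOn]
  · simp [hg.extend_apply]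
  · intro e _ he
    rw [Function.extend_apply', Pi.zero_apply, zero_mul]
    rintro ⟨a, rfl⟩
    simp at he

/-- Deleting edges of a multigraph contracts the edges of its dual. -/
lemma IsDualPair.exists_restrict (h : IsDualPair s t l r) {E' : Type} [Fintype E'] {g : E' → E}
    (hg : Function.Injective g) :
    ∃ (F' : Type) (l' r' : E' → F'), IsDualPair (s ∘ g) (t ∘ g) l' r' := by
  refine ⟨Quot fun f f' => ∃ e ∉ Set.range g, l e = f ∧ r e = f', fun e => Quot.mk _ (l (g e)),
    fun e => Quot.mk _ (r (g e)), fun c => ?_⟩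
  have hdiv : ∀ v, chainDiv (s ∘ g) (t ∘ g) c v = chainDiv s t (Function.extend g c 0) v := by
    classical
    exact fun v => (sum_extend_zero hg c
      (fun e => (if s e = v then 1 else 0) + if t e = v then 1 else 0)).symm
  simp only [hdiv, h (Function.extend g c 0)]
  constructor
  · rintro ⟨a, ha⟩
    refine ⟨Quot.lift a ?_, fun e => ?_⟩
    · rintro f f' ⟨e, he, rfl, rfl⟩
      have := ha e
      rw [Function.extend_apply' _ _ _ he, Pi.zero_apply] at this
      exact CharTwo.add_eq_zero.1 this.symm
    · simpa [hg.extend_apply] using ha (g e)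
  · rintro ⟨a, ha⟩
    refine ⟨fun f => a (Quot.mk _ f), fun e => ?_⟩
    by_cases he : e ∈ Set.range g
    · obtain ⟨e, rfl⟩ := he
      rw [hg.extend_apply, ha]
    · rw [Function.extend_apply' _ _ _ he, Pi.zero_apply]
      exact (CharTwo.add_eq_zero.2 (congrArg a (Quot.sound ⟨e, he, rfl, rfl⟩))).symm

open Classical in
lemma exists_chain_of_reflTransGen {P : V → V → Prop} {w w' : V}
    (h : Relation.ReflTransGen (fun a b => P a b ∧ ∃ e, s(s e, t e) = s(a, b)) w w')
    (hP : ∀ a b, P a b → P b a) :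
    ∃ d : E → ZMod 2, (∀ e, ¬ P (s e) (t e) → d e = 0) ∧
      ∀ v, chainDiv s t d v = (if w = v then 1 else 0) + if w' = v then 1 else 0 := by
  induction h with
  | refl => exact ⟨0, fun _ _ => rfl, fun v => by simp [chainDiv, CharTwo.add_self_eq_zero]⟩
  | @tail a b _ hab ih =>
    obtain ⟨d, hd, hdv⟩ := ih
    obtain ⟨hab, e, he⟩ := hab
    refine ⟨d + Pi.single e 1, fun e' he' => ?_, fun v => ?_⟩
    · have : e' ≠ e := by
        rintro rfl
        rcases Sym2.eq_iff.1 he with h | h <;> rw [h.1, h.2] at he'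
        · exact he' hab
        · exact he' (hP _ _ hab)
      simp [this, hd e' he']
    · have hs : ((if s e = v then 1 else 0) + if t e = v then 1 else 0 : ZMod 2) =
          (if a = v then 1 else 0) + if b = v then 1 else 0 := by
        rcases Sym2.eq_iff.1 he with h | h <;> rw [h.1, h.2]
        rw [add_comm]
      rw [chainDiv_add, hdv, chainDiv_single, hs, add_assoc, ← add_assoc (if a = v then _ else _),
        CharTwo.add_self_eq_zero, zero_add]

open Classical in
lemma chainDiv_fiber [Fintype W] {s t : E → W} (φ : W → V) (c : E → ZMod 2) (v : V) :
    chainDiv (fun e : {e // φ (s e) ≠ φ (t e)} => φ (s e)) (fun e => φ (t e)) (fun e => c e) v =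
      ∑ w, (if φ w = v then 1 else 0) * chainDiv s t c w := by
  have h1 : ∀ x : W, (∑ w, (if φ w = v then 1 else 0) * (if x = w then (1 : ZMod 2) else 0)) =
      if φ x = v then 1 else 0 := by
    intro x
    simp
  simp only [chainDiv, Finset.mul_sum]
  rw [Finset.sum_comm]
  have h2 : ∀ e, (∑ w, (if φ w = v then 1 else 0) *
      (c e * ((if s e = w then 1 else 0) + if t e = w then 1 else 0))) =
      c e * ((if φ (s e) = v then 1 else 0) + if φ (t e) = v then 1 else 0) := by
    intro e
    rw [← h1, ← h1, ← Finset.sum_add_distrib, Finset.mul_sum]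
    exact Finset.sum_congr rfl fun w _ => by ring
  simp only [h2]
  rw [← Finset.sum_subtype (Finset.univ.filter fun e => φ (s e) ≠ φ (t e)) (by simp)
    (fun e => c e * ((if φ (s e) = v then 1 else 0) + if φ (t e) = v then 1 else 0))]
  refine Finset.sum_filter_of_ne fun e _ he h => ?_
  rw [h, CharTwo.add_self_eq_zero, mul_zero] at he
  exact he rfl

open Classical in
/-- Contracting connected vertex sets of a multigraph deletes edges of its dual. -/
lemma IsDualPair.contract [Fintype W] {s t : E → W} (h : IsDualPair s t l r) (φ : W → V)
    (hφ : ∀ w w', φ w = φ w' →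
      Relation.ReflTransGen (fun a b => φ a = φ b ∧ ∃ e, s(s e, t e) = s(a, b)) w w') :
    IsDualPair (fun e : {e // φ (s e) ≠ φ (t e)} => φ (s e)) (fun e => φ (t e))
      (fun e => l e) (fun e => r e) := by
  intro c'
  constructor
  · intro hc'
    set c0 : E → ZMod 2 := fun e => if h : φ (s e) ≠ φ (t e) then c' ⟨e, h⟩ else 0 with hc0
    have hres : (fun e : {e // φ (s e) ≠ φ (t e)} => c0 e) = c' := by
      ext e
      simp [hc0, e.2]
    have hfib : ∀ v, (∑ w, (if φ w = v then 1 else 0) * chainDiv s t c0 w) = 0 := fun v => by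
      rw [← chainDiv_fiber, hres, hc']
    set root : W → W := fun w => Quotient.out (s := Setoid.ker φ) (Quotient.mk _ w) with hroot
    have hr1 : ∀ w, φ w = φ (root w) := fun w => (Quotient.mk_out (s := Setoid.ker φ) w).symm
    have hr2 : ∀ w w', φ w = φ w' → root w = root w' := fun w w' h =>
      congrArg Quotient.out (Quotient.sound (s := Setoid.ker φ) h)
    choose d hd hdv using fun w =>
      exists_chain_of_reflTransGen (hφ w (root w) (hr1 w)) fun a b => Eq.symm
    have hc : ∀ v, chainDiv s t (c0 + fun e => ∑ w, chainDiv s t c0 w * d w e) v = 0 := by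
      intro v
      rw [chainDiv_add, chainDiv_sum_smul]
      simp only [hdv, mul_add, Finset.sum_add_distrib]
      have h1 : ∑ w, chainDiv s t c0 w * (if w = v then 1 else 0) = chainDiv s t c0 v := by simp
      rw [h1, ← add_assoc, CharTwo.add_self_eq_zero, zero_add]
      by_cases hv : ∃ w, root w = v
      · obtain ⟨w0, rfl⟩ := hv
        refine (Finset.sum_congr rfl fun w _ => ?_).trans (hfib (φ w0))
        rw [mul_comm]
        congr 1
        refine if_congr ⟨fun h => ?_, hr2 _ _⟩ rfl rfl
        rw [hr1 w, h, ← hr1]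
      · push Not at hv
        simp [hv]
    obtain ⟨a, ha⟩ := (h _).1 hc
    refine ⟨a, fun e => ?_⟩
    rw [← ha, Pi.add_apply, Finset.sum_eq_zero fun w _ => by rw [hd w e e.2, mul_zero], add_zero,
      ← hres]
  · rintro ⟨a, ha⟩ v
    have := (h fun e => a (l e) + a (r e)).2 ⟨a, fun _ => rfl⟩
    rw [funext ha, chainDiv_fiber φ (fun e => a (l e) + a (r e))]
    simp [this]

end Chains

section Grid

/-- The lattice edges are `((x, y), true)` from `(x, y)` to `(x + 1, y)` and `((x, y), false)` from
`(x, y)` to `(x, y + 1)`; this is the second end. -/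
def latticeEnd (k : (ℤ × ℤ) × Bool) : ℤ × ℤ :=
  if k.2 then (k.1.1 + 1, k.1.2) else (k.1.1, k.1.2 + 1)

/-- The face to the lower right of a lattice edge; the other one is indexed by its first end. -/
def latticeFace (k : (ℤ × ℤ) × Bool) : ℤ × ℤ :=
  if k.2 then (k.1.1, k.1.2 - 1) else (k.1.1 - 1, k.1.2)

variable {E : Type} [Fintype E] {g : E → (ℤ × ℤ) × Bool}

open Classical in
lemma sum_ite_eq_extend (hg : Function.Injective g) (c : E → ZMod 2) (k : (ℤ × ℤ) × Bool) :
    (∑ e, if g e = k then c e else 0) = Function.extend g c 0 k := by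
  by_cases hk : ∃ e, g e = k
  · obtain ⟨e, rfl⟩ := hk
    simp [hg.eq_iff, hg.extend_apply]
  · rw [Function.extend_apply' _ _ _ hk]
    push Not at hk
    simp [hk]

lemma chainDiv_lattice (hg : Function.Injective g) (c : E → ZMod 2) (x y : ℤ) :
    chainDiv (fun e => (g e).1) (fun e => latticeEnd (g e)) c (x, y) =
      Function.extend g c 0 ((x, y), true) + Function.extend g c 0 ((x, y), false) +
        Function.extend g c 0 ((x - 1, y), true) + Function.extend g c 0 ((x, y - 1), false) := by
  classical
  simp only [← sum_ite_eq_extend hg, ← Finset.sum_add_distrib]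
  refine Finset.sum_congr rfl fun e _ => ?_
  obtain ⟨⟨⟨x', y'⟩, b⟩, hk⟩ : ∃ k, g e = k := ⟨_, rfl⟩
  have h1 : x' + 1 = x ↔ x' = x - 1 := by omega
  have h2 : y' + 1 = y ↔ y' = y - 1 := by omega
  cases b <;> simp [hk, latticeEnd, h1, h2, mul_add]

/-- A finite subgraph of the square lattice has a dual. -/
lemma exists_isDualPair_lattice (hg : Function.Injective g) :
    ∃ (F : Type) (l r : E → F),
      IsDualPair (fun e => (g e).1) (fun e => latticeEnd (g e)) l r := by
  refine ⟨Quot fun f f' => ∃ k ∉ Set.range g, k.1 = f ∧ latticeFace k = f',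
    fun e => Quot.mk _ (g e).1, fun e => Quot.mk _ (latticeFace (g e)), fun c => ?_⟩
  set C := Function.extend g c 0 with hC
  have hdiv := chainDiv_lattice hg c
  rw [← hC] at hdiv
  have h0 : ∀ k ∉ Set.range g, C k = 0 := fun k hk => by
    rw [hC, Function.extend_apply' _ _ _ hk, Pi.zero_apply]
  have h1 : ∀ e, C (g e) = c e := fun e => by rw [hC, hg.extend_apply]
  constructor
  · intro hc
    obtain ⟨N, hN⟩ : ∃ N : ℤ, ∀ k : (ℤ × ℤ) × Bool, k.1.1 ≤ N → C k = 0 := by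
      obtain ⟨N, hN⟩ := (Set.finite_range fun e => (g e).1.1).bddBelow
      refine ⟨N - 1, fun k hk => h0 k ?_⟩
      rintro ⟨e, rfl⟩
      have : N ≤ (g e).1.1 := hN ⟨e, rfl⟩
      omega
    set a : ℤ × ℤ → ZMod 2 := fun p => ∑ i ∈ Finset.Ioc N p.1, C ((i, p.2), false) with ha
    have hv : ∀ x y, a (x, y) = a (x - 1, y) + C ((x, y), false) := by
      intro x y
      rcases lt_or_ge N x with h | h
      · have : Finset.Ioc N x = insert x (Finset.Ioc N (x - 1)) := by
          ext i
          simp only [Finset.mem_Ioc, Finset.mem_insert]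
          omega
        simp only [ha]
        rw [this, Finset.sum_insert (by simp), add_comm]
      · rw [hN _ h]
        simp only [ha]
        rw [Finset.Ioc_eq_empty (by omega), Finset.Ioc_eq_empty (by omega)]
        simp
    have hh : ∀ x y, C ((x, y), true) = a (x, y) + a (x, y - 1) := by
      intro x y
      rcases lt_or_ge x N with h | h
      · rw [hN _ h.le]
        simp only [ha]
        rw [Finset.Ioc_eq_empty (by omega)]
        simp
      induction x, h using Int.leInduction with
      | base =>
        rw [hN _ le_rfl]
        simp [ha]
      | succ x hx ih =>
        have := hc (x + 1, y)
        rw [hdiv, add_sub_cancel_right, ih] at this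
        rw [hv (x + 1) y, hv (x + 1) (y - 1), add_sub_cancel_right]
        grind
    have hall : ∀ k, C k = a k.1 + a (latticeFace k) := by
      rintro ⟨⟨x, y⟩, b⟩
      cases b
      · simp only [latticeFace, Bool.false_eq_true, if_false]
        rw [hv x y]
        grind
      · simpa [latticeFace] using hh x y
    refine ⟨Quot.lift a ?_, fun e => ?_⟩
    · rintro f f' ⟨k, hk, rfl, rfl⟩
      have := hall k
      rw [h0 k hk] at this
      exact CharTwo.add_eq_zero.1 this.symm
    · rw [← h1, hall]
  · rintro ⟨a, ha⟩ ⟨x, y⟩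
    set A : ℤ × ℤ → ZMod 2 := fun p => a (Quot.mk _ p) with hA
    have hall : ∀ k, C k = A k.1 + A (latticeFace k) := by
      intro k
      by_cases hk : k ∈ Set.range g
      · obtain ⟨e, rfl⟩ := hk
        rw [h1, ha]
      · rw [h0 k hk]
        exact (CharTwo.add_eq_zero.2 (congrArg a (Quot.sound ⟨k, hk, rfl, rfl⟩))).symm
    rw [hdiv]
    simp only [hall, latticeFace, if_true, Bool.false_eq_true, if_false]
    grind

end Grid

/-- A multigraph with edge ends `l, r` that is an algebraic dual of the simple graph `G`. -/
structure PlaneDual {V : Type} (G : SimpleGraph V) where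
  E : Type
  [fintype : Fintype E]
  s : E → V
  t : E → V
  F : Type
  l : E → F
  r : E → F
  dual : IsDualPair s t l r
  adj : ∀ e, G.Adj (s e) (t e)
  inj : ∀ e e', s(s e, t e) = s(s e', t e') → e = e'
  surj : ∀ {u v}, G.Adj u v → ∃ e, s(s e, t e) = s(u, v)

attribute [instance] PlaneDual.fintype

/-- Two points of the square lattice are adjacent. -/
def LatticeAdj (p q : ℤ × ℤ) : Prop := ∃ k, s(k.1, latticeEnd k) = s(p, q)

section PlaneDual

variable {V W : Type} {G : SimpleGraph V}

/-- A graph has a dual if its edges are among those of a multigraph with a dual. -/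
lemma PlaneDual.nonempty_of_cover {E F : Type} [Fintype E] {s t : E → V} {l r : E → F}
    (h : IsDualPair s t l r) (hG : ∀ u v, G.Adj u v → ∃ e, s(s e, t e) = s(u, v)) :
    Nonempty (PlaneDual G) := by
  classical
  have hG' : ∀ x : G.edgeSet, ∃ e, s(s e, t e) = x := by
    rintro ⟨x, hx⟩
    induction x with
    | _ u v => exact hG u v hx
  choose g hg using hG'
  have hinj : Function.Injective g := fun x y hxy => by
    rw [Subtype.ext_iff, ← hg, ← hg, hxy]
  let : Fintype G.edgeSet := Fintype.ofInjective g hinj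
  obtain ⟨F', l', r', hd⟩ := h.exists_restrict hinj
  exact ⟨{
    E := G.edgeSet, s := s ∘ g, t := t ∘ g, F := F', l := l', r := r', dual := hd
    adj := fun x => by
      rw [← SimpleGraph.mem_edgeSet, Function.comp, Function.comp, hg]
      exact x.2
    inj := fun x y hxy => by
      simp only [Function.comp, hg] at hxy
      exact Subtype.ext hxy
    surj := fun {u v} huv => ⟨⟨s(u, v), huv⟩, hg _⟩ }⟩

lemma PlaneDual.nonempty_of_injective (D : PlaneDual G) {H : SimpleGraph W} {ι : W → V}
    (hι : Function.Injective ι) (hH : ∀ u v, H.Adj u v → G.Adj (ι u) (ι v)) :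
    Nonempty (PlaneDual H) := by
  classical
  have hs : ∀ x : H.edgeSet, ∃ e : D.E, ∃ u v, x.1 = s(u, v) ∧ ι u = D.s e ∧ ι v = D.t e := by
    rintro ⟨x, hx⟩
    induction x with
    | _ u v =>
      obtain ⟨e, he⟩ := D.surj (hH u v hx)
      rcases Sym2.eq_iff.1 he with h | h
      · exact ⟨e, u, v, rfl, h.1.symm, h.2.symm⟩
      · exact ⟨e, v, u, Sym2.eq_swap, h.1.symm, h.2.symm⟩
  choose g s t hst hs ht using hs
  have hinj : Function.Injective g := fun x y hxy => by
    have h1 : s x = s y := hι (by rw [hs, hs, hxy])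
    have h2 : t x = t y := hι (by rw [ht, ht, hxy])
    rw [Subtype.ext_iff, hst, hst, h1, h2]
  let : Fintype H.edgeSet := Fintype.ofInjective g hinj
  obtain ⟨F', l', r', hd⟩ := D.dual.exists_restrict hinj
  have hd' : IsDualPair s t l' r' := by
    refine IsDualPair.of_comp_injective hι ?_
    rwa [show ι ∘ s = D.s ∘ g from funext hs, show ι ∘ t = D.t ∘ g from funext ht]
  exact PlaneDual.nonempty_of_cover hd' fun u v huv => ⟨⟨s(u, v), huv⟩, (hst ⟨s(u, v), huv⟩).symm⟩

/-- A minor of the square lattice has a dual. -/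
lemma PlaneDual.nonempty_of_branchSets [Finite V] (B : V → Set (ℤ × ℤ))
    (hfin : ∀ v, (B v).Finite) (hdisj : ∀ u v p, p ∈ B u → p ∈ B v → u = v)
    (hconn : ∀ v, ∀ p ∈ B v, ∀ q ∈ B v,
      Relation.ReflTransGen (fun a b => (a ∈ B v ∧ b ∈ B v) ∧ LatticeAdj a b) p q)
    (hadj : ∀ u v, G.Adj u v → ∃ p ∈ B u, ∃ q ∈ B v, LatticeAdj p q) :
    Nonempty (PlaneDual G) := by
  classical
  have hU : (⋃ v, B v).Finite := Set.finite_iUnion hfin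
  let W := {p // p ∈ ⋃ v, B v}
  have : Finite W := hU
  let : Fintype W := Fintype.ofFinite W
  let E := {k : (ℤ × ℤ) × Bool // k.1 ∈ ⋃ v, B v ∧ latticeEnd k ∈ ⋃ v, B v}
  have : Finite E := Finite.of_injective (β := W × Bool) (fun e => (⟨e.1.1, e.2.1⟩, e.1.2))
    fun a b hab => by
      rw [Prod.mk.injEq] at hab
      exact Subtype.ext (Prod.ext (congrArg Subtype.val hab.1) hab.2)
  let : Fintype E := Fintype.ofFinite E
  obtain ⟨F, l, r, h⟩ := exists_isDualPair_lattice (g := fun e : E => e.1) Subtype.val_injective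
  have h' : IsDualPair (fun e : E => (⟨e.1.1, e.2.1⟩ : W)) (fun e => ⟨latticeEnd e.1, e.2.2⟩) l r :=
    IsDualPair.of_comp_injective (ι := fun w : W => w.1) Subtype.val_injective h
  choose φ hφ using fun w : W => Set.mem_iUnion.1 w.2
  have hφ' : ∀ v p (hp : p ∈ B v), φ ⟨p, Set.mem_iUnion.2 ⟨v, hp⟩⟩ = v := fun v p hp =>
    hdisj _ _ p (hφ ⟨p, _⟩) hp
  have hedge : ∀ u v p q (hp : p ∈ B u) (hq : q ∈ B v), LatticeAdj p q →
      ∃ e : E, s((⟨e.1.1, e.2.1⟩ : W), ⟨latticeEnd e.1, e.2.2⟩) =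
        s(⟨p, Set.mem_iUnion.2 ⟨u, hp⟩⟩, ⟨q, Set.mem_iUnion.2 ⟨v, hq⟩⟩) := by
    rintro u v p q hp hq ⟨k, hk⟩
    rcases Sym2.eq_iff.1 hk with h | h
    · refine ⟨⟨k, h.1 ▸ Set.mem_iUnion.2 ⟨u, hp⟩, h.2 ▸ Set.mem_iUnion.2 ⟨v, hq⟩⟩, ?_⟩
      exact Sym2.eq_iff.2 (Or.inl ⟨Subtype.ext h.1, Subtype.ext h.2⟩)
    · refine ⟨⟨k, h.1 ▸ Set.mem_iUnion.2 ⟨v, hq⟩, h.2 ▸ Set.mem_iUnion.2 ⟨u, hp⟩⟩, ?_⟩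
      exact Sym2.eq_iff.2 (Or.inr ⟨Subtype.ext h.1, Subtype.ext h.2⟩)
  refine PlaneDual.nonempty_of_cover (h'.contract φ ?_) fun u v huv => ?_
  · rintro ⟨p, hp⟩ ⟨q, hq⟩ hpq
    have hp' := hφ ⟨p, hp⟩
    have hq' := hφ ⟨q, hq⟩
    rw [← hpq] at hq'
    generalize φ ⟨p, hp⟩ = v at hp' hq'
    have := hconn v p hp' q hq'
    clear hpq
    induction this with
    | refl => exact Relation.ReflTransGen.refl
    | @tail a b _ hab ih =>
      refine (ih (Set.mem_iUnion.2 ⟨v, hab.1.1⟩) hab.1.1).tail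
        ⟨?_, hedge _ _ _ _ hab.1.1 hab.1.2 hab.2⟩
      rw [hφ' v a hab.1.1, hφ' v b hab.1.2]
  · obtain ⟨p, hp, q, hq, hpq⟩ := hadj u v huv
    obtain ⟨e, he⟩ := hedge u v p q hp hq hpq
    have he' : s(φ ⟨e.1.1, e.2.1⟩, φ ⟨latticeEnd e.1, e.2.2⟩) = s(u, v) := by
      have := congrArg (Sym2.map φ) he
      simpa only [Sym2.map_mk, hφ' u p hp, hφ' v q hq] using this
    refine ⟨⟨e, fun h => ?_⟩, he'⟩
    rw [h] at he'
    rcases Sym2.eq_iff.1 he' with ⟨h1, h2⟩ | ⟨h1, h2⟩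
    · exact huv.ne (h1.symm.trans h2)
    · exact huv.ne (h2.symm.trans h1)

end PlaneDual

section Topology

open Filter Topology

lemma LatticeAdj.symm {p q : ℤ × ℤ} (h : LatticeAdj p q) : LatticeAdj q p := by
  obtain ⟨k, hk⟩ := h
  exact ⟨k, hk.trans Sym2.eq_swap⟩

lemma latticeAdj_right (x y : ℤ) : LatticeAdj (x, y) (x + 1, y) := ⟨((x, y), true), rfl⟩

lemma latticeAdj_up (x y : ℤ) : LatticeAdj (x, y) (x, y + 1) := ⟨((x, y), false), rfl⟩

/-- Any two points of `I` are joined by a path of lattice steps inside `I`, starting from the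
first. -/
def LatticeReach (I : Set (ℤ × ℤ)) : ℤ × ℤ → ℤ × ℤ → Prop :=
  Relation.ReflTransGen fun a b => (a ∈ I ∧ b ∈ I) ∧ LatticeAdj a b

lemma LatticeReach.symm {I : Set (ℤ × ℤ)} {p q : ℤ × ℤ} (h : LatticeReach I p q) :
    LatticeReach I q p := by
  induction h with
  | refl => exact Relation.ReflTransGen.refl
  | tail _ h ih => exact Relation.ReflTransGen.head ⟨h.1.symm, h.2.symm⟩ ih

lemma LatticeReach.mono {I J : Set (ℤ × ℤ)} (hIJ : I ⊆ J) {p q : ℤ × ℤ} (h : LatticeReach I p q) :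
    LatticeReach J p q := by
  induction h with
  | refl => exact Relation.ReflTransGen.refl
  | tail _ h ih => exact ih.tail ⟨⟨hIJ h.1.1, hIJ h.1.2⟩, h.2⟩

lemma latticeReach_horizontal {I : Set (ℤ × ℤ)} {x x' y : ℤ} (hx : x ≤ x')
    (h : ∀ i, x ≤ i → i ≤ x' → (i, y) ∈ I) : LatticeReach I (x, y) (x', y) := by
  induction x', hx using Int.leInduction with
  | base => exact Relation.ReflTransGen.refl
  | succ z hz ih =>
    exact (ih fun i h1 h2 => h i h1 (by omega)).tail
      ⟨⟨h z hz (by omega), h (z + 1) (by omega) le_rfl⟩, latticeAdj_right z y⟩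

lemma latticeReach_vertical {I : Set (ℤ × ℤ)} {x y y' : ℤ} (hy : y ≤ y')
    (h : ∀ i, y ≤ i → i ≤ y' → (x, i) ∈ I) : LatticeReach I (x, y) (x, y') := by
  induction y', hy using Int.leInduction with
  | base => exact Relation.ReflTransGen.refl
  | succ z hz ih =>
    exact (ih fun i h1 h2 => h i h1 (by omega)).tail
      ⟨⟨h z hz (by omega), h (z + 1) (by omega) le_rfl⟩, latticeAdj_up x z⟩

lemma latticeReach_prod {I J : Set ℤ} (hI : I.OrdConnected) (hJ : J.OrdConnected) {p q : ℤ × ℤ}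
    (hp : p ∈ I ×ˢ J) (hq : q ∈ I ×ˢ J) : LatticeReach (I ×ˢ J) p q := by
  have h1 : LatticeReach (I ×ˢ J) p (q.1, p.2) := by
    rcases le_total p.1 q.1 with h | h
    · exact latticeReach_horizontal h fun i h1 h2 => ⟨hI.out hp.1 hq.1 ⟨h1, h2⟩, hp.2⟩
    · refine LatticeReach.symm ?_
      exact latticeReach_horizontal h fun i h1 h2 => ⟨hI.out hq.1 hp.1 ⟨h1, h2⟩, hp.2⟩
  refine Relation.ReflTransGen.trans h1 ?_
  change LatticeReach (I ×ˢ J) _ _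
  rcases le_total p.2 q.2 with h | h
  · exact latticeReach_vertical h fun i h1 h2 => ⟨hq.1, hJ.out hp.2 hq.2 ⟨h1, h2⟩⟩
  · refine LatticeReach.symm ?_
    exact latticeReach_vertical h fun i h1 h2 => ⟨hq.1, hJ.out hq.2 hp.2 ⟨h1, h2⟩⟩

variable {V : Type} {G : SimpleGraph V}

/-- A graph has a dual if it is drawn on the square lattice with vertices fattened to the sets
`box v` and edges to the sets `S u v`. -/
lemma PlaneDual.nonempty_of_lattice_drawing [Finite V] (box : V → Set (ℤ × ℤ))
    (S : V → V → Set (ℤ × ℤ)) (c : V → ℤ × ℤ) (hboxfin : ∀ v, (box v).Finite)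
    (hSfin : ∀ u v, G.Adj u v → (S u v).Finite) (hc : ∀ v, c v ∈ box v)
    (hbox : ∀ v, ∀ p ∈ box v, LatticeReach (box v) (c v) p)
    (hS : ∀ u v, G.Adj u v → LatticeReach (S u v) (c u) (c v))
    (hdisj : ∀ u v p, p ∈ box u → p ∈ box v → u = v)
    (havoid : ∀ u v w p, G.Adj u v → p ∈ S u v → p ∈ box w → w = u ∨ w = v)
    (hcross : ∀ u v x y p, G.Adj u v → G.Adj x y → ({u, v} : Set V) ≠ {x, y} → p ∈ S u v →
      p ∈ S x y → ∃ w, p ∈ box w) :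
    Nonempty (PlaneDual G) := by
  classical
  let _ : LinearOrder V := linearOrderOfSTO WellOrderingRel
  set A : V → Set (ℤ × ℤ) := fun u =>
    box u ∪ {p | ∃ v, u < v ∧ G.Adj u v ∧ p ∈ S u v ∧ p ∉ box v} with hA
  have hAdisj : ∀ u v p, p ∈ A u → p ∈ A v → u = v := by
    have key : ∀ u v p, p ∈ box u → p ∈ A v → u = v := by
      rintro u v p hu (hv | ⟨w, -, hvw, hp, hpw⟩)
      · exact hdisj u v p hu hv
      · rcases havoid v w u p hvw hp hu with rfl | rfl
        · rfl
        · exact absurd hu hpw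
    rintro u v p (hu | ⟨u', huu, hadj, hp, hpu⟩) hv
    · exact key u v p hu hv
    · rcases id hv with hv' | ⟨v', hvv, hadj', hp', hpv⟩
      · exact (key v u p hv' (Or.inr ⟨u', huu, hadj, hp, hpu⟩)).symm
      · by_cases he : ({u, u'} : Set V) = {v, v'}
        · rcases Set.pair_eq_pair_iff.1 he with h | h
          · exact h.1
          · rw [h.1, h.2] at huu
            exact absurd huu hvv.not_gt
        · obtain ⟨w, hw⟩ := hcross _ _ _ _ p hadj hadj' he hp hp'
          exact (key w u p hw (Or.inr ⟨u', huu, hadj, hp, hpu⟩)).symm.trans (key w v p hw hv)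
  have hBA : ∀ v p, LatticeReach (A v) (c v) p → p ∈ A v := by
    intro v p h
    rcases Relation.ReflTransGen.cases_tail h with h | ⟨_, -, h⟩
    · exact h ▸ Or.inl (hc v)
    · exact h.1.2
  have hstep : ∀ v p q, LatticeReach (A v) (c v) p → q ∈ A v → LatticeAdj p q →
      LatticeReach (A v) (c v) q := fun v p q hp hq hpq => hp.tail ⟨⟨hBA v p hp, hq⟩, hpq⟩
  have hlt : ∀ u v, u < v → G.Adj u v → ∃ p, LatticeReach (A u) (c u) p ∧
      ∃ q, LatticeReach (A v) (c v) q ∧ LatticeAdj p q := by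
    intro u v huv hadj
    by_contra! hcon
    have h : ∀ q, LatticeReach (S u v) (c u) q → LatticeReach (A u) (c u) q := by
      intro q hq
      induction hq with
      | refl => exact Relation.ReflTransGen.refl
      | @tail a b _ hab ih =>
        by_cases hb : b ∈ box v
        · exact absurd hab.2 (hcon a ih b ((hbox v b hb).mono Set.subset_union_left))
        · exact hstep u a b ih (Or.inr ⟨v, huv, hadj, hab.1.2, hb⟩) hab.2
    exact huv.ne (hAdisj u v _ (hBA u _ (h _ (hS u v hadj))) (Or.inl (hc v)))
  refine PlaneDual.nonempty_of_branchSets (fun v => {p | LatticeReach (A v) (c v) p})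
    (fun v => ?_) (fun u v p hu hv => hAdisj u v p (hBA u p hu) (hBA v p hv))
    (fun v p hp q hq => ?_) fun u v huv => ?_
  · refine Set.Finite.subset ((hboxfin v).union (Set.finite_iUnion (ι := {w // G.Adj v w})
      fun w => hSfin v w w.2)) fun p hp => ?_
    rcases hBA v p hp with h | ⟨w, -, hvw, hpw, -⟩
    · exact Or.inl h
    · exact Or.inr (Set.mem_iUnion.2 ⟨⟨w, hvw⟩, hpw⟩)
  · have h : ∀ p, LatticeReach (A v) (c v) p →
        LatticeReach {p | LatticeReach (A v) (c v) p} (c v) p := by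
      intro p h
      induction h with
      | refl => exact Relation.ReflTransGen.refl
      | @tail a b ha hab ih => exact ih.tail ⟨⟨ha, ha.tail hab⟩, hab.2⟩
    exact Relation.ReflTransGen.trans (h p hp).symm (h q hq)
  · rcases lt_or_gt_of_ne huv.ne with h | h
    · exact hlt u v h huv
    · obtain ⟨p, hp, q, hq, hpq⟩ := hlt v u h huv.symm
      exact ⟨q, hq, p, hp, hpq.symm⟩

/-- The point of the plane represented by a lattice point, with mesh `h`. -/
def meshPoint (h : ℝ) (p : ℤ × ℤ) : ℝ × ℝ := (h * p.1, h * p.2)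

/-- The lattice point of the cell of mesh `h` containing `x`. -/
noncomputable def meshCell (h : ℝ) (x : ℝ × ℝ) : ℤ × ℤ := (⌊x.1 / h⌋, ⌊x.2 / h⌋)

variable {h : ℝ}

lemma abs_mul_floor_div_sub_le (hh : 0 < h) (x : ℝ) : |h * ⌊x / h⌋ - x| ≤ h := by
  have h1 := Int.floor_le (x / h)
  have h2 := (Int.lt_floor_add_one (x / h)).le
  rw [le_div_iff₀ hh] at h1
  rw [div_le_iff₀ hh] at h2
  rw [abs_le]
  constructor <;> linarith

lemma dist_meshPoint_le {p : ℤ × ℤ} {x : ℝ × ℝ} {C : ℝ} :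
    dist (meshPoint h p) x ≤ C ↔ |h * p.1 - x.1| ≤ C ∧ |h * p.2 - x.2| ≤ C := by
  rw [Prod.dist_eq, max_le_iff, Real.dist_eq, Real.dist_eq, meshPoint]

lemma dist_meshPoint_meshCell_le (hh : 0 < h) (x : ℝ × ℝ) :
    dist (meshPoint h (meshCell h x)) x ≤ h :=
  dist_meshPoint_le.2 ⟨abs_mul_floor_div_sub_le hh _, abs_mul_floor_div_sub_le hh _⟩

lemma finite_preimage_meshPoint (hh : 0 < h) {K : Set (ℝ × ℝ)} (hK : Bornology.IsBounded K) :
    {p | meshPoint h p ∈ K}.Finite := by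
  obtain ⟨C, hC⟩ := hK.subset_closedBall 0
  refine ((Set.finite_Icc (-⌈C / h⌉) ⌈C / h⌉).prod
    (Set.finite_Icc (-⌈C / h⌉) ⌈C / h⌉)).subset fun p hp => ?_
  have h1 := dist_meshPoint_le.1 (Metric.mem_closedBall.1 (hC hp))
  have key : ∀ i : ℤ, |h * i - 0| ≤ C → i ∈ Set.Icc (-⌈C / h⌉) ⌈C / h⌉ := by
    intro i hi
    rw [sub_zero, abs_le] at hi
    have h2 : (i : ℝ) ≤ C / h := (le_div_iff₀ hh).2 (by linarith)
    have h3 : (-i : ℝ) ≤ C / h := (le_div_iff₀ hh).2 (by linarith)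
    have h4 : (i : ℝ) ≤ ⌈C / h⌉ := h2.trans (Int.le_ceil _)
    have h5 : (-i : ℝ) ≤ ⌈C / h⌉ := h3.trans (Int.le_ceil _)
    constructor
    · have : -i ≤ ⌈C / h⌉ := by exact_mod_cast h5
      omega
    · exact_mod_cast h4
  exact ⟨key _ h1.1, key _ h1.2⟩

lemma latticeReach_ball (hh : 0 < h) {x : ℝ × ℝ} {C : ℝ} {p q : ℤ × ℤ}
    (hp : dist (meshPoint h p) x ≤ C) (hq : dist (meshPoint h q) x ≤ C) :
    LatticeReach {p | dist (meshPoint h p) x ≤ C} p q := by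
  have hord : ∀ y : ℝ, {i : ℤ | |h * i - y| ≤ C}.OrdConnected := by
    refine fun y => ⟨fun i hi j hj k hk => ?_⟩
    rw [Set.mem_ofPred_eq, abs_le] at hi hj ⊢
    have h1 : (i : ℝ) ≤ k := by exact_mod_cast hk.1
    have h2 : (k : ℝ) ≤ j := by exact_mod_cast hk.2
    constructor <;> nlinarith
  exact (latticeReach_prod (hord x.1) (hord x.2) (dist_meshPoint_le.1 hp)
    (dist_meshPoint_le.1 hq)).mono fun r hr => dist_meshPoint_le.2 hr

lemma latticeReach_path (hh : 0 < h) {T : Type} [TopologicalSpace T] [PreconnectedSpace T]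
    {γ : T → ℝ × ℝ} (hγ : Continuous γ) (a b : T) :
    LatticeReach {p | ∃ t, dist (meshPoint h p) (γ t) ≤ 2 * h} (meshCell h (γ a))
      (meshCell h (γ b)) := by
  set S := {p | ∃ t, dist (meshPoint h p) (γ t) ≤ 2 * h} with hS
  have hloc : IsLocallyConstant fun t => LatticeReach S (meshCell h (γ a)) (meshCell h (γ t)) := by
    rw [IsLocallyConstant.iff_eventually_eq]
    intro t
    filter_upwards [hγ.continuousAt.eventually (Metric.ball_mem_nhds (γ t) hh)] with t' ht'
    have h1 : dist (meshPoint h (meshCell h (γ t'))) (γ t) ≤ 2 * h := by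
      have := dist_triangle (meshPoint h (meshCell h (γ t'))) (γ t') (γ t)
      have := dist_meshPoint_meshCell_le hh (γ t')
      have : dist (γ t') (γ t) < h := ht'
      linarith
    have h2 : dist (meshPoint h (meshCell h (γ t))) (γ t) ≤ 2 * h := by
      have := dist_meshPoint_meshCell_le hh (γ t)
      linarith
    have h3 : LatticeReach S (meshCell h (γ t)) (meshCell h (γ t')) := by
      refine (latticeReach_ball hh h2 h1).mono ?_
      exact fun p hp => ⟨t, hp⟩
    exact propext ⟨fun h => Relation.ReflTransGen.trans h h3.symm,
      fun h => Relation.ReflTransGen.trans h h3⟩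
  rw [← hloc.apply_eq_of_preconnectedSpace a b]
  exact Relation.ReflTransGen.refl

lemma exists_pos_forall_lt_dist {T : Type} [TopologicalSpace T] [CompactSpace T]
    {f g : T → ℝ × ℝ} (hf : Continuous f) (hg : Continuous g) {K : Set T} (hK : IsClosed K)
    (hfg : ∀ t ∈ K, f t ≠ g t) : ∀ᶠ ε : ℝ in 𝓝[>] 0, ∀ t ∈ K, ε < dist (f t) (g t) := by
  obtain ⟨ε, hε, h⟩ := hK.isCompact.exists_forall_le' (hf.dist hg).continuousOn
    fun t ht => dist_pos.2 (hfg t ht)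
  filter_upwards [Ioo_mem_nhdsGT hε] with x hx t ht
  exact hx.2.trans_le (h t ht)

/-- A finite plane graph has a dual. -/
lemma PlaneEmbedding.nonempty_planeDual [Finite V] (P : PlaneEmbedding G) :
    Nonempty (PlaneDual G) := by
  have hev1 : ∀ᶠ ε : ℝ in 𝓝[>] 0, ∀ u v, u ≠ v → ε < dist (P.pos u) (P.pos v) := by
    simp only [eventually_all]
    intro u v huv
    filter_upwards [Ioo_mem_nhdsGT (dist_pos.2 (P.pos_inj.ne huv))] with x hx using hx.2
  have hev2 : ∀ᶠ ε : ℝ in 𝓝[>] 0, ∀ u v w, G.Adj u v → w ≠ u → w ≠ v →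
      ∀ t, ε < dist (P.arc u v t) (P.pos w) := by
    simp only [eventually_all]
    intro u v w huv hu hv
    filter_upwards [exists_pos_forall_lt_dist (P.arc_cont u v huv)
      (continuous_const (y := P.pos w)) isClosed_univ fun t _ h =>
        P.arc_avoid u v w huv hu hv ⟨t, h⟩] with x hx t using hx t trivial
  obtain ⟨δ', ⟨h1, h2⟩, hδ'⟩ := ((hev1.and hev2).and self_mem_nhdsWithin).exists
  obtain ⟨δ, rfl⟩ : ∃ δ, δ' = 2 * δ := ⟨δ' / 2, by ring⟩
  have hδ : 0 < δ := by simpa using hδ'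
  have hev3 : ∀ᶠ ε : ℝ in 𝓝[>] 0, ∀ u v x y, G.Adj u v → G.Adj x y →
      ({u, v} : Set V) ≠ {x, y} → ∀ t ∈ {t : Set.Icc (0 : ℝ) 1 × Set.Icc (0 : ℝ) 1 |
        ∀ w, δ / 2 ≤ dist (P.arc u v t.1) (P.pos w)},
      ε < dist (P.arc u v t.1) (P.arc x y t.2) := by
    simp only [eventually_all]
    intro u v x y huv hxy hne
    have c1 := (P.arc_cont u v huv).comp
      (continuous_fst (X := Set.Icc (0 : ℝ) 1) (Y := Set.Icc (0 : ℝ) 1))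
    have c2 := (P.arc_cont x y hxy).comp
      (continuous_snd (X := Set.Icc (0 : ℝ) 1) (Y := Set.Icc (0 : ℝ) 1))
    refine exists_pos_forall_lt_dist c1 c2 ?_ ?_
    · simp only [Set.ofPred_forall]
      exact isClosed_iInter fun w => isClosed_le continuous_const (c1.dist continuous_const)
    · intro t ht he
      obtain ⟨w, -, hw⟩ := P.arcs_meet_only_at_endpoints u v x y huv hxy hne
        ⟨⟨t.1, rfl⟩, ⟨t.2, he.symm⟩⟩
      have := ht w
      rw [hw, dist_self] at this
      linarith
  obtain ⟨ε, ⟨h3, hεδ⟩, hε⟩ := ((hev3.and (Ioo_mem_nhdsGT hδ)).and self_mem_nhdsWithin).exists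
  obtain ⟨h, rfl⟩ : ∃ h, ε = 4 * h := ⟨ε / 4, by ring⟩
  have hh : 0 < h := by simpa using hε
  have hhδ : 4 * h < δ := hεδ.2
  refine PlaneDual.nonempty_of_lattice_drawing (fun v => {p | dist (meshPoint h p) (P.pos v) ≤ δ})
    (fun u v => {p | ∃ t, dist (meshPoint h p) (P.arc u v t) ≤ 2 * h})
    (fun v => meshCell h (P.pos v)) (fun v => ?_) (fun u v huv => ?_) (fun v => ?_)
    (fun v p hp => ?_) (fun u v huv => ?_) (fun u v p hu hv => ?_) (fun u v w p huv hp hw => ?_)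
    fun u v x y p huv hxy hne hp hp' => ?_
  · exact finite_preimage_meshPoint hh Metric.isBounded_closedBall
  · refine (finite_preimage_meshPoint hh ((isCompact_range
      (P.arc_cont u v huv)).isBounded.cthickening (δ := 2 * h))).subset ?_
    rintro p ⟨t, ht⟩
    exact Metric.mem_cthickening_of_dist_le _ _ _ _ ⟨t, rfl⟩ ht
  · exact (dist_meshPoint_meshCell_le hh _).trans (by linarith)
  · exact latticeReach_ball hh ((dist_meshPoint_meshCell_le hh _).trans (by linarith)) hp
  · rw [← P.arc_start u v huv, ← P.arc_end u v huv]
    exact latticeReach_path hh (P.arc_cont u v huv) _ _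
  · by_contra huv
    have := h1 u v huv
    have := dist_triangle_left (P.pos u) (P.pos v) (meshPoint h p)
    have : dist (meshPoint h p) (P.pos u) ≤ δ := hu
    have : dist (meshPoint h p) (P.pos v) ≤ δ := hv
    linarith
  · by_contra! hne
    obtain ⟨t, ht⟩ := hp
    have := h2 u v w huv hne.1 hne.2 t
    have := dist_triangle_left (P.arc u v t) (P.pos w) (meshPoint h p)
    have : dist (meshPoint h p) (P.pos w) ≤ δ := hw
    linarith
  · obtain ⟨t, ht⟩ := hp
    obtain ⟨t', ht'⟩ := hp'
    by_contra! hcon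
    have := h3 u v x y huv hxy hne (t, t') fun w => by
      have := hcon w
      have := dist_triangle (meshPoint h p) (P.arc u v t) (P.pos w)
      have : ¬ dist (meshPoint h p) (P.pos w) ≤ δ := hcon w
      linarith
    have := dist_triangle_left (P.arc u v t) (P.arc x y t') (meshPoint h p)
    linarith

end Topology

section Faces

variable {V W : Type} {G : SimpleGraph V} (D : PlaneDual G)

namespace PlaneDual

open Classical in
/-- The boundary of a face, as a mod 2 chain. -/
noncomputable def bd (f : D.F) (e : D.E) : ZMod 2 :=
  (if D.l e = f then 1 else 0) + if D.r e = f then 1 else 0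

lemma bd_ne_zero_iff {f : D.F} {e : D.E} : D.bd f e ≠ 0 ↔ (D.l e = f ↔ D.r e ≠ f) := by
  unfold bd
  by_cases h1 : D.l e = f <;> by_cases h2 : D.r e = f <;> simp [h1, h2, CharTwo.add_self_eq_zero]

lemma chainDiv_bd (f : D.F) (v : V) : chainDiv D.s D.t (D.bd f) v = 0 := by
  classical
  exact (D.dual (D.bd f)).2 ⟨fun g => if g = f then 1 else 0, fun e => rfl⟩ v

/-- A cycle does not have exactly one edge at a vertex. -/
lemma exists_ne_of_chainDiv_eq_zero {c : D.E → ZMod 2} {v : V} (hc : chainDiv D.s D.t c v = 0)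
    {e : D.E} (he : c e ≠ 0) (hv : v ∈ s(D.s e, D.t e)) :
    ∃ e', e' ≠ e ∧ c e' ≠ 0 ∧ v ∈ s(D.s e', D.t e') := by
  classical
  by_contra! h
  rw [chainDiv, Finset.sum_eq_single e _ (by simp)] at hc
  · have hne := (D.adj e).ne
    rcases mul_eq_zero.1 hc with h' | h'
    · exact he h'
    · rcases Sym2.mem_iff.1 hv with rfl | rfl
      · simp [hne.symm] at h'
      · simp [hne] at h'
  · intro e' _ he'
    by_cases h0 : c e' = 0
    · rw [h0, zero_mul]
    · have := h e' he' h0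
      rw [Sym2.mem_iff] at this
      push Not at this
      simp [this.1.symm, this.2.symm]

/-- The cycle space of a nonempty multigraph has dimension at least `|E| - |V| + 1`. -/
lemma exists_cycle_submodule [Fintype V] [Nonempty V] {E : Type} [Fintype E]
    (s t : E → V) : ∃ Z : Submodule (ZMod 2) (E → ZMod 2), (∀ c ∈ Z, ∀ v, chainDiv s t c v = 0) ∧
      Fintype.card E + 1 ≤ Module.finrank (ZMod 2) Z + Fintype.card V := by
  classical
  let div : (E → ZMod 2) →ₗ[ZMod 2] (V → ZMod 2) :=
    { toFun := chainDiv s t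
      map_add' := fun c d => funext fun v => chainDiv_add c d v
      map_smul' := fun k c => funext fun v => by
        simp [chainDiv, Finset.mul_sum, mul_assoc] }
  let tot : (V → ZMod 2) →ₗ[ZMod 2] ZMod 2 := ∑ v, LinearMap.proj v
  have htot : ∀ x, tot x = ∑ v, x v := fun x => by simp [tot]
  refine ⟨LinearMap.ker div, fun c hc v => congrFun hc v, ?_⟩
  have h1 := LinearMap.finrank_range_add_finrank_ker div
  have h2 := LinearMap.finrank_range_add_finrank_ker tot
  have h3 : LinearMap.range div ≤ LinearMap.ker tot := by
    rintro _ ⟨c, rfl⟩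
    rw [LinearMap.mem_ker, htot]
    change ∑ v, chainDiv s t c v = 0
    simp only [chainDiv]
    rw [Finset.sum_comm]
    refine Finset.sum_eq_zero fun e _ => ?_
    rw [← Finset.mul_sum, Finset.sum_add_distrib]
    simp [CharTwo.add_self_eq_zero]
  have h4 : LinearMap.range tot = ⊤ := by
    rw [LinearMap.range_eq_top]
    intro k
    obtain ⟨v⟩ := ‹Nonempty V›
    exact ⟨Pi.single v k, by simp [htot]⟩
  have h5 := Submodule.finrank_mono h3
  rw [h4, finrank_top, Module.finrank_self] at h2
  rw [Module.finrank_fintype_fun_eq_card] at h1 h2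
  omega

/-- Euler's formula, with the consequence that a sparse enough plane graph has a short face. -/
lemma exists_short_face [Fintype V] [Nonempty V]
    (h : 5 * Fintype.card V ≤ 3 * Fintype.card D.E + 2) :
    ∃ f, (∃ e, D.bd f e ≠ 0) ∧ (Finset.univ.filter fun e => D.bd f e ≠ 0).card ≤ 4 := by
  classical
  by_contra! hcon
  obtain ⟨Z, hZ, hrank⟩ := exists_cycle_submodule D.s D.t
  let F' : Finset D.F :=
    (Finset.univ.image D.l ∪ Finset.univ.image D.r).filter fun f => ∃ e, D.bd f e ≠ 0
  have hF' : ∀ f, f ∈ F' ↔ ∃ e, D.bd f e ≠ 0 := by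
    intro f
    simp only [F', Finset.mem_filter, Finset.mem_union, Finset.mem_image, Finset.mem_univ, true_and,
      and_iff_right_iff_imp]
    rintro ⟨e, he⟩
    rw [bd_ne_zero_iff] at he
    by_cases hl : D.l e = f
    · exact Or.inl ⟨e, hl⟩
    · exact Or.inr ⟨e, by tauto⟩
  have hsum : ∀ (a : D.F → ZMod 2) e, ∑ f ∈ F', a f * D.bd f e = a (D.l e) + a (D.r e) := by
    intro a e
    by_cases hlr : D.l e = D.r e
    · rw [hlr, CharTwo.add_self_eq_zero]
      exact Finset.sum_eq_zero fun f _ => by simp [bd, hlr, CharTwo.add_self_eq_zero]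
    · have hl : D.l e ∈ F' := (hF' _).2 ⟨e, by rw [bd_ne_zero_iff]; tauto⟩
      have hr : D.r e ∈ F' := (hF' _).2 ⟨e, by rw [bd_ne_zero_iff]; tauto⟩
      simp [bd, mul_add, Finset.sum_add_distrib, hl, hr]
  let φ : (F' → ZMod 2) →ₗ[ZMod 2] (D.E → ZMod 2) :=
    { toFun := fun a e => ∑ f, a f * D.bd f e
      map_add' := fun a b => funext fun e => by simp [add_mul, Finset.sum_add_distrib]
      map_smul' := fun k a => funext fun e => by simp [Finset.mul_sum, mul_assoc] }
  have hφ : ∀ (a : D.F → ZMod 2) e, φ (fun f => a f) e = a (D.l e) + a (D.r e) := fun a e => by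
    rw [← hsum]
    exact Finset.sum_coe_sort F' fun f => a f * D.bd f e
  have h1 := LinearMap.finrank_range_add_finrank_ker φ
  have h2 : Z ≤ LinearMap.range φ := by
    intro c hc
    obtain ⟨a, ha⟩ := (D.dual c).1 (hZ c hc)
    exact ⟨fun f => a f, funext fun e => by rw [hφ, ha]⟩
  have h3 := Submodule.finrank_mono h2
  rw [Module.finrank_fintype_fun_eq_card, Fintype.card_coe] at h1
  have hV : 0 < Fintype.card V := Fintype.card_pos
  rcases F'.eq_empty_or_nonempty with hem | ⟨f0, hf0⟩
  · have := Finset.card_eq_zero.2 hem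
    omega
  · have h4 : 0 < Module.finrank (ZMod 2) (LinearMap.ker φ) := by
      have : (fun _ => 1 : F' → ZMod 2) ∈ LinearMap.ker φ := by
        rw [LinearMap.mem_ker]
        ext e
        exact (hφ (fun _ => 1) e).trans (CharTwo.add_self_eq_zero _)
      have hne : LinearMap.ker φ ≠ ⊥ := by
        intro hbot
        rw [hbot, Submodule.mem_bot] at this
        exact one_ne_zero (congrFun this ⟨f0, hf0⟩)
      exact Submodule.one_le_finrank_iff.2 hne
    have h5 : ∑ f ∈ F', (Finset.univ.filter fun e => D.bd f e ≠ 0).card ≤ 2 * Fintype.card D.E := by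
      have := Finset.sum_card_bipartiteAbove_eq_sum_card_bipartiteBelow (s := F')
        (t := (Finset.univ : Finset D.E)) (fun f e => D.bd f e ≠ 0)
      simp only [Finset.bipartiteAbove, Finset.bipartiteBelow] at this
      rw [this, mul_comm, ← smul_eq_mul, ← Finset.card_univ]
      refine Finset.sum_le_card_nsmul _ _ _ fun e _ => ?_
      refine (Finset.card_le_card (t := {D.l e, D.r e}) fun f hf => ?_).trans Finset.card_le_two
      have := (Finset.mem_filter.1 hf).2
      rw [bd_ne_zero_iff] at this
      rw [Finset.mem_insert, Finset.mem_singleton]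
      tauto
    have h6 : F'.card * 5 ≤ ∑ f ∈ F', (Finset.univ.filter fun e => D.bd f e ≠ 0).card := by
      rw [← smul_eq_mul]
      exact Finset.card_nsmul_le_sum _ _ _ fun f hf => by
        convert Nat.succ_le_of_lt (hcon f ((hF' f).1 hf))
    omega

/-- The cycle `x y z u` of length four bounds the face `f`. -/
structure IsFourFace (f : D.F) (x y z u : V) : Prop where
  xy : G.Adj x y
  yz : G.Adj y z
  zu : G.Adj z u
  ux : G.Adj u x
  xz : x ≠ z
  yu : y ≠ u
  face : ∀ e, s(D.s e, D.t e) = s(x, y) ∨ s(D.s e, D.t e) = s(y, z) ∨ s(D.s e, D.t e) = s(z, u) ∨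
    s(D.s e, D.t e) = s(u, x) → D.bd f e ≠ 0

variable {D}

lemma IsFourFace.rotate {f : D.F} {x y z u : V} (h : D.IsFourFace f x y z u) :
    D.IsFourFace f y z u x :=
  ⟨h.yz, h.zu, h.ux, h.xy, h.yu, h.xz.symm, fun e he => h.face e (by tauto)⟩

variable (D)

lemma adj_of_sym2_eq {e : D.E} {u v : V} (h : s(D.s e, D.t e) = s(u, v)) : G.Adj u v := by
  rw [← SimpleGraph.mem_edgeSet, ← h]
  exact D.adj e

lemma exists_isFourFace_of_card_le (htf : ∀ a b c, G.Adj a b → G.Adj b c → ¬ G.Adj c a)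
    {f : D.F} (hf : ∃ e, D.bd f e ≠ 0)
    (hcard : (Finset.univ.filter fun e => D.bd f e ≠ 0).card ≤ 4) :
    ∃ x y z u, D.IsFourFace f x y z u := by
  classical
  have step : ∀ e u v, D.bd f e ≠ 0 → s(D.s e, D.t e) = s(u, v) → ∃ e' w, D.bd f e' ≠ 0 ∧
      s(D.s e', D.t e') = s(v, w) ∧ w ≠ u ∧ e' ≠ e := by
    intro e u v he huv
    obtain ⟨e', h1, h2, h3⟩ := D.exists_ne_of_chainDiv_eq_zero (D.chainDiv_bd f v) he
      (by rw [huv]; exact Sym2.mem_mk_right u v)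
    obtain ⟨w, hw⟩ := h3
    refine ⟨e', w, h2, hw, ?_, h1⟩
    rintro rfl
    exact h1 (D.inj _ _ (by rw [hw, huv, Sym2.eq_swap]))
  obtain ⟨e1, h1⟩ := hf
  obtain ⟨x, hx⟩ : ∃ x, x = D.s e1 := ⟨_, rfl⟩
  obtain ⟨y, hy⟩ : ∃ y, y = D.t e1 := ⟨_, rfl⟩
  have he1 : s(D.s e1, D.t e1) = s(x, y) := by rw [hx, hy]
  obtain ⟨e2, z, h2, he2, hzx, -⟩ := step e1 x y h1 he1
  obtain ⟨e3, u, h3, he3, huy, -⟩ := step e2 y z h2 he2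
  obtain ⟨e4, w, h4, he4, hwy, -⟩ := step e1 y x h1 (he1.trans Sym2.eq_swap)
  obtain ⟨e5, q, h5, he5, hqz, h53⟩ := step e3 z u h3 he3
  have a1 := D.adj_of_sym2_eq he1
  have a2 := D.adj_of_sym2_eq he2
  have a3 := D.adj_of_sym2_eq he3
  have a4 := D.adj_of_sym2_eq he4
  have a5 := D.adj_of_sym2_eq he5
  have hux : u ≠ x := by
    rintro rfl
    exact htf _ _ _ a1 a2 a3
  have hne : ∀ {e e' : D.E} {p p' : Sym2 V}, s(D.s e, D.t e) = p → s(D.s e', D.t e') = p' →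
      p ≠ p' → e ≠ e' := by
    rintro e e' _ _ rfl rfl h rfl
    exact h rfl
  have n12 : e1 ≠ e2 := hne he1 he2 (by simp [a1.ne, hzx.symm])
  have n13 : e1 ≠ e3 := hne he1 he3 (by simp [hzx.symm, hux.symm])
  have n14 : e1 ≠ e4 := hne he1 he4 (by simp [hwy.symm, a1.ne'])
  have n23 : e2 ≠ e3 := hne he2 he3 (by simp [a2.ne, huy.symm])
  have n24 : e2 ≠ e4 := hne he2 he4 (by simp [a1.ne', hzx])
  have n34 : e3 ≠ e4 := hne he3 he4 (by simp [hzx, hux])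
  have hall : ({e1, e2, e3, e4} : Finset D.E) = Finset.univ.filter fun e => D.bd f e ≠ 0 := by
    refine Finset.eq_of_subset_of_card_le (fun e he => ?_) (hcard.trans_eq ?_)
    · simp only [Finset.mem_insert, Finset.mem_singleton] at he
      rw [Finset.mem_filter]
      rcases he with rfl | rfl | rfl | rfl <;> exact ⟨Finset.mem_univ _, ‹_›⟩
    · rw [Finset.card_insert_of_notMem, Finset.card_insert_of_notMem, Finset.card_pair n34]
      · simp [n23, n24]
      · simp [n12, n13, n14]
  have hm5 : e5 ∈ ({e1, e2, e3, e4} : Finset D.E) := by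
    rw [hall, Finset.mem_filter]
    exact ⟨Finset.mem_univ _, h5⟩
  simp only [Finset.mem_insert, Finset.mem_singleton] at hm5
  have hxq : q = x := by
    rcases hm5 with rfl | rfl | rfl | rfl
    · rw [he1] at he5
      simp [hux.symm, huy.symm] at he5
    · rw [he2] at he5
      simp [huy.symm, a3.ne] at he5
    · exact absurd rfl h53
    · rw [he4] at he5
      simp [hux.symm] at he5
      exact he5.1.symm
  subst hxq
  refine ⟨q, y, z, u, a1, a2, a3, a5, hzx.symm, huy.symm, fun e he => ?_⟩
  rcases he with he | he | he | he
  · rwa [D.inj e e1 (he.trans he1.symm)]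
  · rwa [D.inj e e2 (he.trans he2.symm)]
  · rwa [D.inj e e3 (he.trans he3.symm)]
  · rwa [D.inj e e5 (he.trans he5.symm)]

end PlaneDual

end Faces

section Identification

variable {V W : Type} {G : SimpleGraph V} (D : PlaneDual G)

namespace PlaneDual

/-- The edge of the multigraph representing an edge of `G`. -/
noncomputable def edge {u v : V} (h : G.Adj u v) : D.E := (D.surj h).choose

lemma edge_spec {u v : V} (h : G.Adj u v) : s(D.s (D.edge h), D.t (D.edge h)) = s(u, v) :=
  (D.surj h).choose_spec

lemma edge_eq_edge_iff {u v u' v' : V} (h : G.Adj u v) (h' : G.Adj u' v') :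
    D.edge h = D.edge h' ↔ s(u, v) = s(u', v') := by
  rw [← D.edge_spec h, ← D.edge_spec h']
  exact ⟨fun h => by rw [h], D.inj _ _⟩

open Classical in
lemma chainDiv_single_edge {u v : V} (h : G.Adj u v) (w : V) :
    chainDiv D.s D.t (Pi.single (D.edge h) 1) w =
      (if u = w then 1 else 0) + if v = w then 1 else 0 := by
  rw [chainDiv_single]
  rcases Sym2.eq_iff.1 (D.edge_spec h) with h | h <;> rw [h.1, h.2]
  rw [add_comm]

/-- A cycle of length five is a cut of the dual, with the given face on the zero side. -/
lemma exists_cut_of_five_cycle {a b c d e : V} (hab : G.Adj a b) (hbc : G.Adj b c)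
    (hcd : G.Adj c d) (hde : G.Adj d e) (hea : G.Adj e a) (hac : a ≠ c) (had : a ≠ d) (hbd : b ≠ d)
    (hbe : b ≠ e) (hce : c ≠ e) (f : D.F) : ∃ S : D.F → ZMod 2, S f = 0 ∧
      ∀ k, S (D.l k) + S (D.r k) = 1 ∧ (k = D.edge hab ∨ k = D.edge hbc ∨ k = D.edge hcd ∨
        k = D.edge hde ∨ k = D.edge hea) ∨ S (D.l k) + S (D.r k) = 0 ∧ ¬ (k = D.edge hab ∨
          k = D.edge hbc ∨ k = D.edge hcd ∨ k = D.edge hde ∨ k = D.edge hea) := by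
  classical
  set C : D.E → ZMod 2 := Pi.single (D.edge hab) 1 + Pi.single (D.edge hbc) 1 +
    Pi.single (D.edge hcd) 1 + Pi.single (D.edge hde) 1 + Pi.single (D.edge hea) 1 with hC
  have hdiv : ∀ v, chainDiv D.s D.t C v = 0 := by
    intro v
    simp only [hC, chainDiv_add, chainDiv_single_edge]
    generalize (if a = v then (1 : ZMod 2) else 0) = i1
    generalize (if b = v then (1 : ZMod 2) else 0) = i2
    generalize (if c = v then (1 : ZMod 2) else 0) = i3
    generalize (if d = v then (1 : ZMod 2) else 0) = i4
    generalize (if e = v then (1 : ZMod 2) else 0) = i5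
    grind
  obtain ⟨S, hS⟩ := (D.dual C).1 hdiv
  refine ⟨fun g => S g + S f, CharTwo.add_self_eq_zero _, fun k => ?_⟩
  have h1 : S (D.l k) + S f + (S (D.r k) + S f) = C k := by
    rw [hS]
    grind
  have h12 : D.edge hab ≠ D.edge hbc := by simp [edge_eq_edge_iff, hab.ne, hac]
  have h13 : D.edge hab ≠ D.edge hcd := by simp [edge_eq_edge_iff, hac, had]
  have h14 : D.edge hab ≠ D.edge hde := by simp [edge_eq_edge_iff, had, hea.ne']
  have h15 : D.edge hab ≠ D.edge hea := by simp [edge_eq_edge_iff, hab.ne', hea.ne', hbe]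
  have h23 : D.edge hbc ≠ D.edge hcd := by simp [edge_eq_edge_iff, hbc.ne, hbd]
  have h24 : D.edge hbc ≠ D.edge hde := by simp [edge_eq_edge_iff, hbd, hbe]
  have h25 : D.edge hbc ≠ D.edge hea := by simp [edge_eq_edge_iff, hbe, hab.ne']
  have h34 : D.edge hcd ≠ D.edge hde := by simp [edge_eq_edge_iff, hcd.ne, hce]
  have h35 : D.edge hcd ≠ D.edge hea := by simp [edge_eq_edge_iff, hce, hac.symm]
  have h45 : D.edge hde ≠ D.edge hea := by simp [edge_eq_edge_iff, hde.ne, had.symm]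
  rw [h1, hC]
  simp only [Pi.add_apply, Pi.single_apply]
  by_cases k1 : k = D.edge hab
  · subst k1
    simp [h12, h13, h14, h15]
  by_cases k2 : k = D.edge hbc
  · subst k2
    simp [h12.symm, h23, h24, h25]
  by_cases k3 : k = D.edge hcd
  · subst k3
    simp [h13.symm, h23.symm, h34, h35]
  by_cases k4 : k = D.edge hde
  · subst k4
    simp [h14.symm, h24.symm, h34.symm, h45]
  by_cases k5 : k = D.edge hea
  · subst k5
    simp [h15.symm, h25.symm, h35.symm, h45.symm]
  simp [k1, k2, k3, k4, k5]

variable {D}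

/-- Two paths of length three cannot cross outside a facial cycle of length four. -/
lemma IsFourFace.not_crossing (htf : ∀ a b c, G.Adj a b → G.Adj b c → ¬ G.Adj c a) {f : D.F}
    {x y z u v w v' w' : V} (h : D.IsFourFace f x y z u) (hxv : G.Adj x v) (hvw : G.Adj v w)
    (hwz : G.Adj w z) (hyv : G.Adj y v') (hvw' : G.Adj v' w') (hwu : G.Adj w' u) : False := by
  have hxz := h.xz
  have hyu := h.yu
  have hxy := h.xy
  have hyz := h.yz
  have hzu := h.zu
  have hux := h.ux
  have n1 : v ≠ y := by rintro rfl; exact htf _ _ _ hvw hwz hyz.symm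
  have n2 : v ≠ u := by rintro rfl; exact htf _ _ _ hvw hwz hzu
  have n3 : w ≠ y := by rintro rfl; exact htf _ _ _ hxv hvw hxy.symm
  have n4 : w ≠ u := by rintro rfl; exact htf _ _ _ hxv hvw hux
  have n5 : v' ≠ x := by rintro rfl; exact htf _ _ _ hvw' hwu hux
  have n6 : v' ≠ z := by rintro rfl; exact htf _ _ _ hvw' hwu hzu.symm
  have n7 : w' ≠ x := by rintro rfl; exact htf _ _ _ hyv hvw' hxy
  have n8 : w' ≠ z := by rintro rfl; exact htf _ _ _ hyv hvw' hyz.symm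
  have m1 : v ≠ v' := by rintro rfl; exact htf _ _ _ hxy hyv hxv.symm
  have m2 : v ≠ w' := by rintro rfl; exact htf _ _ _ hxv hwu hux
  have m3 : w ≠ v' := by rintro rfl; exact htf _ _ _ hyz hwz.symm hyv.symm
  have m4 : w ≠ w' := by rintro rfl; exact htf _ _ _ hwz hzu hwu.symm
  have n9 : v ≠ z := by rintro rfl; exact htf _ _ _ hxy hyz hxv.symm
  have n10 : w ≠ x := by rintro rfl; exact htf _ _ _ hxy hyz hwz.symm
  have n11 : v' ≠ u := by rintro rfl; exact htf _ _ _ hux hxy hyv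
  have n12 : w' ≠ y := by rintro rfl; exact htf _ _ _ hux hxy hwu
  obtain ⟨S, hSf, hS⟩ := D.exists_cut_of_five_cycle hxv hvw hwz hyz.symm hxy.symm n10.symm hxz n9 n1
    n3 f
  obtain ⟨T, hTf, hT⟩ := D.exists_cut_of_five_cycle hyv hvw' hwu hzu.symm hyz.symm n12.symm hyu n11
    n6 n8 f
  set c : D.E → ZMod 2 := fun e => S (D.l e) * T (D.l e) + S (D.r e) * T (D.r e) with hc
  have hcyc : ∀ p, chainDiv D.s D.t c p = 0 := (D.dual c).2 ⟨fun g => S g * T g, fun e => rfl⟩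
  have hface : ∀ e, D.bd f e ≠ 0 → (D.l e = f ∨ D.r e = f) := by
    intro e he
    rw [bd_ne_zero_iff] at he
    tauto
  have hcST : ∀ e, c e = S (D.l e) * T (D.l e) + S (D.r e) * T (D.r e) := fun e => rfl
  have cxy : c (D.edge hxy.symm) = 0 := by
    have h1 := hface _ (h.face (D.edge hxy.symm) (Or.inl ((D.edge_spec _).trans Sym2.eq_swap)))
    have h2 := hT (D.edge hxy.symm)
    simp only [edge_eq_edge_iff, Sym2.eq_iff] at h2
    have h3 : T (D.l (D.edge hxy.symm)) + T (D.r (D.edge hxy.symm)) = 0 := by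
      rcases h2 with h2 | h2
      · exfalso
        have := h2.2
        grind
      · exact h2.1
    rw [hcST]
    rcases h1 with h1 | h1 <;> rw [h1, hTf] at h3 ⊢ <;> grind
  have czu : c (D.edge hzu.symm) = 0 := by
    have h1 := hface _ (h.face (D.edge hzu.symm)
      (Or.inr (Or.inr (Or.inl ((D.edge_spec _).trans Sym2.eq_swap)))))
    have h2 := hS (D.edge hzu.symm)
    simp only [edge_eq_edge_iff, Sym2.eq_iff] at h2
    have h3 : S (D.l (D.edge hzu.symm)) + S (D.r (D.edge hzu.symm)) = 0 := by
      rcases h2 with h2 | h2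
      · exfalso
        have := h2.2
        grind
      · exact h2.1
    rw [hcST]
    rcases h1 with h1 | h1 <;> rw [h1, hSf] at h3 ⊢ <;> grind
  have cyz : c (D.edge hyz.symm) ≠ 0 := by
    have h1 := hface _ (h.face (D.edge hyz.symm) (Or.inr (Or.inl
      ((D.edge_spec _).trans Sym2.eq_swap))))
    have h2 := hS (D.edge hyz.symm)
    have h3 := hT (D.edge hyz.symm)
    simp only [true_or, or_true, and_true, not_true, and_false, or_false] at h2 h3
    rw [hcST]
    rcases h1 with h1 | h1 <;> rw [h1] at h2 h3 ⊢ <;> rw [hSf] at h2 ⊢ <;> rw [hTf] at h3 ⊢ <;>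
      grind
  have hsupp : ∀ k, c k ≠ 0 → (k = D.edge hxv ∨ k = D.edge hvw ∨ k = D.edge hwz ∨
      k = D.edge hyz.symm ∨ k = D.edge hxy.symm) ∨ (k = D.edge hyv ∨ k = D.edge hvw' ∨
        k = D.edge hwu ∨ k = D.edge hzu.symm ∨ k = D.edge hyz.symm) := by
    intro k hk
    by_contra hcon
    have h1 := (hS k).resolve_left fun h => hcon (Or.inl h.2)
    have h2 := (hT k).resolve_left fun h => hcon (Or.inr h.2)
    apply hk
    rw [hcST, CharTwo.add_eq_zero.1 h1.1, CharTwo.add_eq_zero.1 h2.1, CharTwo.add_self_eq_zero]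
  have hmem : ∀ {p q r : V} (hpq : G.Adj p q), r ∈ s(D.s (D.edge hpq), D.t (D.edge hpq)) ↔
      r = p ∨ r = q := fun hpq => by rw [D.edge_spec, Sym2.mem_iff]
  have hadj := fun (p : V) (k : D.E) (hk : c k ≠ 0) => D.exists_ne_of_chainDiv_eq_zero (hcyc p) hk
  have cxv : c (D.edge hxv) = 0 := by
    by_contra h0
    obtain ⟨k, hk1, hk2, hk3⟩ := hadj x _ h0 ((hmem _).2 (Or.inl rfl))
    rcases hsupp k hk2 with (rfl | rfl | rfl | rfl | rfl) | (rfl | rfl | rfl | rfl | rfl) <;>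
      rw [hmem] at hk3 <;> grind
  have cvw : c (D.edge hvw) = 0 := by
    by_contra h0
    obtain ⟨k, hk1, hk2, hk3⟩ := hadj v _ h0 ((hmem _).2 (Or.inl rfl))
    rcases hsupp k hk2 with (rfl | rfl | rfl | rfl | rfl) | (rfl | rfl | rfl | rfl | rfl) <;>
      rw [hmem] at hk3 <;> grind
  have cwz : c (D.edge hwz) = 0 := by
    by_contra h0
    obtain ⟨k, hk1, hk2, hk3⟩ := hadj w _ h0 ((hmem _).2 (Or.inl rfl))
    rcases hsupp k hk2 with (rfl | rfl | rfl | rfl | rfl) | (rfl | rfl | rfl | rfl | rfl) <;>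
      rw [hmem] at hk3 <;> grind
  obtain ⟨k, hk1, hk2, hk3⟩ := hadj z _ cyz ((hmem _).2 (Or.inl rfl))
  rcases hsupp k hk2 with (rfl | rfl | rfl | rfl | rfl) | (rfl | rfl | rfl | rfl | rfl) <;>
    rw [hmem] at hk3 <;> grind

end PlaneDual

end Identification

section Main

variable {V W : Type} {G : SimpleGraph V}

/-- Identifying opposite vertices of a facial cycle of length four preserves planarity. -/
lemma PlaneDual.IsFourFace.nonempty_identify {D : PlaneDual G} {f : D.F} {x y z u : V}
    (h : D.IsFourFace f x y z u) {φ : V → W} (hφxz : φ x = φ z)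
    (hφ : ∀ a b, φ a = φ b → a = b ∨ (a = x ∧ b = z) ∨ (a = z ∧ b = x)) {H : SimpleGraph W}
    (hH : ∀ a b, H.Adj a b → ∃ a' b', φ a' = a ∧ φ b' = b ∧ G.Adj a' b') :
    Nonempty (PlaneDual H) := by
  classical
  set P : D.E → Prop := fun e => e = D.edge h.zu ∨ e = D.edge h.ux with hP
  set d : D.E → ZMod 2 := Pi.single (D.edge h.zu) 1 + Pi.single (D.edge h.ux) 1 with hd
  have hne : D.edge h.zu ≠ D.edge h.ux := by
    rw [Ne, PlaneDual.edge_eq_edge_iff]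
    simp [h.zu.ne, h.xz.symm]
  have hdP : ∀ e, d e = if P e then 1 else 0 := by
    intro e
    by_cases h1 : e = D.edge h.zu
    · subst h1
      simp [hd, hP, hne]
    · by_cases h2 : e = D.edge h.ux
      · subst h2
        simp [hd, hP, hne.symm]
      · simp [hd, hP, h1, h2]
  have hddiv : ∀ v, chainDiv D.s D.t d v =
      (if x = v then 1 else 0) + if z = v then 1 else 0 := by
    intro v
    rw [hd, chainDiv_add, PlaneDual.chainDiv_single_edge, PlaneDual.chainDiv_single_edge]
    grind
  have hbd : ∀ e, P e → (D.l e = f ↔ D.r e ≠ f) := by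
    intro e he
    rw [← D.bd_ne_zero_iff]
    rcases he with rfl | rfl
    · exact h.face _ (Or.inr (Or.inr (Or.inl (D.edge_spec _))))
    · exact h.face _ (Or.inr (Or.inr (Or.inr (D.edge_spec _))))
  set N : D.E → D.F → Option D.F := fun e g => if P e ∧ g = f then none else some g with hN
  have hdiv : ∀ (c : D.E → ZMod 2) v, v ≠ x → v ≠ z →
      chainDiv (φ ∘ D.s) (φ ∘ D.t) c (φ v) = chainDiv D.s D.t c v := by
    intro c v hx hz
    have : ∀ a, φ a = φ v ↔ a = v := fun a => ⟨fun hav => by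
      rcases hφ a v hav with h | h | h
      · exact h
      · exact absurd h.2 hz
      · exact absurd h.2 hx, fun h => by rw [h]⟩
    simp [chainDiv, this]
  have hdivx : ∀ c : D.E → ZMod 2, chainDiv (φ ∘ D.s) (φ ∘ D.t) c (φ x) =
      chainDiv D.s D.t c x + chainDiv D.s D.t c z := by
    intro c
    have hxz := h.xz
    have : ∀ a, (if φ a = φ x then (1 : ZMod 2) else 0) =
        (if a = x then 1 else 0) + if a = z then 1 else 0 := by
      intro a
      by_cases hx : a = x
      · simp [hx, hxz]
      · by_cases hz : a = z
        · simp [hz, hφxz, hxz.symm]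
        · have : φ a ≠ φ x := fun h => by
            rcases hφ a x h with h | h | h
            · exact hx h
            · exact hx h.1
            · exact hz h.1
          simp [this, hx, hz]
    simp only [chainDiv, Function.comp, this, ← Finset.sum_add_distrib]
    exact Finset.sum_congr rfl fun e _ => by ring
  have hdual : IsDualPair (φ ∘ D.s) (φ ∘ D.t) (fun e => N e (D.l e)) (fun e => N e (D.r e)) := by
    intro c
    have h1 : (∀ w, chainDiv (φ ∘ D.s) (φ ∘ D.t) c w = 0) ↔
        ∃ k : ZMod 2, ∀ v, chainDiv D.s D.t (c + k • d) v = 0 := by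
      have hk : ∀ k : ZMod 2, ∀ v, chainDiv D.s D.t (c + k • d) v = chainDiv D.s D.t c v +
          k * ((if x = v then 1 else 0) + if z = v then 1 else 0) := by
        intro k v
        rw [chainDiv_add, ← hddiv]
        simp [chainDiv, Finset.mul_sum, mul_assoc]
      have hxz := h.xz
      simp only [hk]
      constructor
      · intro hc
        refine ⟨chainDiv D.s D.t c x, fun v => ?_⟩
        by_cases hx : v = x
        · simp [hx, hxz.symm, CharTwo.add_self_eq_zero]
        · by_cases hz : v = z
          · have := hdivx c
            rw [hc] at this
            simp [hz, hxz, add_comm, this.symm]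
          · rw [← hdiv c v hx hz, hc]
            simp [Ne.symm hx, Ne.symm hz]
      · rintro ⟨k, hc⟩ w
        by_cases hw : ∃ v, φ v = w
        · obtain ⟨v, rfl⟩ := hw
          have hx' : chainDiv (φ ∘ D.s) (φ ∘ D.t) c (φ x) = 0 := by
            have e1 := hc x
            have e2 := hc z
            simp only [if_true, hxz.symm, hxz, if_false] at e1 e2
            rw [hdivx]
            grind
          by_cases hx : v = x
          · rw [hx, hx']
          · by_cases hz : v = z
            · rw [hz, ← hφxz, hx']
            · have := hc v
              rw [hdiv c v hx hz]
              simpa [Ne.symm hx, Ne.symm hz] using this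
        · push Not at hw
          simp [chainDiv, hw]
    have h2 : ∀ (a : Option D.F → ZMod 2) e, a (N e (D.l e)) + a (N e (D.r e)) =
        a (some (D.l e)) + a (some (D.r e)) + (a none + a (some f)) * d e := by
      intro a e
      rw [hdP]
      by_cases he : P e
      · have hb := hbd e he
        by_cases hl : D.l e = f
        · have hr := hb.1 hl
          simp only [hN, he, hl, hr, true_and, if_true, if_false]
          grind
        · have hr : D.r e = f := by tauto
          simp only [hN, he, hl, hr, true_and, if_true, if_false]
          grind
      · simp [hN, he]
    rw [h1]
    constructor
    · rintro ⟨k, hc⟩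
      obtain ⟨a, ha⟩ := (D.dual _).1 hc
      refine ⟨fun g => g.elim (a f + k) a, fun e => ?_⟩
      have := ha e
      refine Eq.trans ?_ (h2 (fun g => g.elim (a f + k) a) e).symm
      simp only [Pi.add_apply, Pi.smul_apply, smul_eq_mul, Option.elim] at this ⊢
      grind
    · rintro ⟨a, ha⟩
      refine ⟨a none + a (some f), (D.dual _).2 ⟨fun g => a (some g), fun e => ?_⟩⟩
      have := ha e
      rw [h2] at this
      simp only [Pi.add_apply, Pi.smul_apply, smul_eq_mul]
      grind
  refine PlaneDual.nonempty_of_cover hdual fun a b hab => ?_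
  obtain ⟨a', b', rfl, rfl, hab'⟩ := hH a b hab
  obtain ⟨e, he⟩ := D.surj hab'
  exact ⟨e, by simpa using congrArg (Sym2.map φ) he⟩

lemma not_adj_of_cliqueFree_three (h : G.CliqueFree 3) {a b c : V} (hab : G.Adj a b)
    (hbc : G.Adj b c) : ¬ G.Adj c a := by
  classical
  exact fun hca => h {a, b, c} (SimpleGraph.is3Clique_triple_iff.2 ⟨hab, hca.symm, hbc⟩)

/-- If identifying `x` and `z` creates a triangle, then `x` and `z` are joined by a path of length
three. -/
lemma exists_path_of_identify (htf : G.CliqueFree 3) {x z : V} {φ : V → W} (hφxz : φ x = φ z)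
    (hφ : ∀ a b, φ a = φ b → a = b ∨ (a = x ∧ b = z) ∨ (a = z ∧ b = x)) {H : SimpleGraph W}
    (hH : ∀ a b, H.Adj a b → ∃ a' b', φ a' = a ∧ φ b' = b ∧ G.Adj a' b') (hHtf : ¬ H.CliqueFree 3) :
    ∃ v w, G.Adj x v ∧ G.Adj v w ∧ G.Adj w z := by
  classical
  simp only [SimpleGraph.CliqueFree, not_forall, not_not] at hHtf
  obtain ⟨t, ht⟩ := hHtf
  obtain ⟨a, b, c, hab, hac, hbc, -⟩ := SimpleGraph.is3Clique_iff.1 ht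
  obtain ⟨a1, b1, rfl, rfl, h1⟩ := hH a b hab
  obtain ⟨b2, c2, hb, rfl, h2⟩ := hH _ c hbc
  obtain ⟨c3, a3, hc, ha, h3⟩ := hH _ _ hac.symm
  have hab' := hab.ne
  have hbc' := hbc.ne
  have hac' := hac.ne
  have htri := fun {a b c : V} => not_adj_of_cliqueFree_three htf (a := a) (b := b) (c := c)
  rcases hφ _ _ ha with rfl | ⟨rfl, rfl⟩ | ⟨rfl, rfl⟩
  · rcases hφ _ _ hb with rfl | ⟨rfl, rfl⟩ | ⟨rfl, rfl⟩
    · rcases hφ _ _ hc with rfl | ⟨rfl, rfl⟩ | ⟨rfl, rfl⟩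
      · exact absurd h3 (htri h1 h2)
      · exact ⟨_, _, h3, h1, h2⟩
      · exact ⟨_, _, h2.symm, h1.symm, h3.symm⟩
    · rcases hφ _ _ hc with rfl | ⟨rfl, rfl⟩ | ⟨rfl, rfl⟩
      · exact ⟨_, _, h2, h3, h1⟩
      all_goals grind
    · rcases hφ _ _ hc with rfl | ⟨rfl, rfl⟩ | ⟨rfl, rfl⟩
      · exact ⟨_, _, h1.symm, h3.symm, h2.symm⟩
      all_goals grind
  · rcases hφ _ _ hb with rfl | ⟨rfl, rfl⟩ | ⟨rfl, rfl⟩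
    · rcases hφ _ _ hc with rfl | ⟨rfl, rfl⟩ | ⟨rfl, rfl⟩
      · exact ⟨_, _, h3.symm, h2.symm, h1.symm⟩
      all_goals grind
    all_goals grind
  · rcases hφ _ _ hb with rfl | ⟨rfl, rfl⟩ | ⟨rfl, rfl⟩
    · rcases hφ _ _ hc with rfl | ⟨rfl, rfl⟩ | ⟨rfl, rfl⟩
      · exact ⟨_, _, h1, h2, h3⟩
      all_goals grind
    all_goals grind

/-- In a minimal counterexample, opposite vertices of a facial cycle of length four are joined by
a path of length three. -/
lemma PlaneDual.IsFourFace.exists_path [Fintype V] {D : PlaneDual G} {f : D.F} {x y z u : V}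
    (h : D.IsFourFace f x y z u) (htf : G.CliqueFree 3) (hG : ¬ G.Colorable 3)
    (ih : ∀ (W : Type) [Fintype W] (H : SimpleGraph W), Fintype.card W < Fintype.card V →
      Nonempty (PlaneDual H) → H.CliqueFree 3 → H.Colorable 3) :
    ∃ v w, G.Adj x v ∧ G.Adj v w ∧ G.Adj w z := by
  classical
  set φ : V → {v // v ≠ z} := fun v => if hv : v = z then ⟨x, h.xz⟩ else ⟨v, hv⟩ with hφdef
  have hφz : φ z = ⟨x, h.xz⟩ := by simp [hφdef]
  have hφv : ∀ v (hv : v ≠ z), φ v = ⟨v, hv⟩ := fun v hv => by simp [hφdef, hv]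
  have hφxz : φ x = φ z := by rw [hφz, hφv x h.xz]
  have hφ : ∀ a b, φ a = φ b → a = b ∨ (a = x ∧ b = z) ∨ (a = z ∧ b = x) := by
    intro a b hab
    by_cases ha : a = z
    · by_cases hb : b = z
      · exact Or.inl (ha.trans hb.symm)
      · rw [ha, hφz, hφv b hb] at hab
        exact Or.inr (Or.inr ⟨ha, (congrArg Subtype.val hab).symm⟩)
    · by_cases hb : b = z
      · rw [hb, hφz, hφv a ha] at hab
        exact Or.inr (Or.inl ⟨congrArg Subtype.val hab, hb⟩)
      · rw [hφv a ha, hφv b hb] at hab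
        exact Or.inl (congrArg Subtype.val hab)
  let H : SimpleGraph {v // v ≠ z} := SimpleGraph.fromRel fun a b =>
    ∃ a' b', φ a' = a ∧ φ b' = b ∧ G.Adj a' b'
  have hH : ∀ a b, H.Adj a b → ∃ a' b', φ a' = a ∧ φ b' = b ∧ G.Adj a' b' := by
    rintro a b ⟨-, hab | ⟨a', b', ha, hb, hab⟩⟩
    · exact hab
    · exact ⟨b', a', hb, ha, hab.symm⟩
  refine exists_path_of_identify htf hφxz hφ hH fun hHtf => hG ?_
  obtain ⟨C⟩ := ih _ H (Fintype.card_subtype_lt (x := z) (by simp))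
    (h.nonempty_identify hφxz hφ hH) hHtf
  refine ⟨SimpleGraph.Coloring.mk (fun v => C (φ v)) fun {a b} hab => C.valid ⟨fun he => ?_, ?_⟩⟩
  · rcases hφ a b he with rfl | ⟨rfl, rfl⟩ | ⟨rfl, rfl⟩
    · exact G.irrefl hab
    · exact not_adj_of_cliqueFree_three htf h.xy h.yz hab.symm
    · exact not_adj_of_cliqueFree_three htf h.xy h.yz hab
  · exact Or.inl ⟨a, b, rfl, rfl, hab⟩

lemma colorable_three_iff_colorableOn [Fintype V] : G.Colorable 3 ↔ G.ColorableOn Finset.univ :=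
  ⟨fun ⟨C⟩ => ⟨C, fun _ _ _ _ hab => C.valid hab⟩,
    fun ⟨φ, hφ⟩ => ⟨SimpleGraph.Coloring.mk φ fun hab =>
      hφ _ (Finset.mem_univ _) _ (Finset.mem_univ _) hab⟩⟩

lemma colorableOn_of_colorable_induce {B : Finset V}
    (h : (G.induce (B : Set V)).Colorable 3) : G.ColorableOn B := by
  classical
  obtain ⟨C⟩ := h
  refine ⟨fun v => if hv : v ∈ B then C ⟨v, hv⟩ else 0, fun a ha b hb hab => ?_⟩
  simp only [ha, hb, dif_pos]
  exact C.valid hab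

lemma PlaneDual.adjPairs_univ [Fintype V] (D : PlaneDual G) :
    G.adjPairs Finset.univ Finset.univ = 2 * Fintype.card D.E := by
  classical
  have h1 : ∀ a b, (if G.Adj a b then (1 : ℤ) else 0) =
      ∑ e : D.E, ((if D.s e = a ∧ D.t e = b then 1 else 0) +
        if D.t e = a ∧ D.s e = b then 1 else 0) := by
    intro a b
    by_cases hab : G.Adj a b
    · rw [if_pos hab, Finset.sum_eq_single (D.edge hab)]
      · rcases Sym2.eq_iff.1 (D.edge_spec hab) with h | h <;> simp [h.1, h.2, hab.ne, hab.ne']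
      · intro e _ he
        have h1 : ¬ (D.s e = a ∧ D.t e = b) := fun h => he (D.inj _ _ (by
          rw [D.edge_spec, h.1, h.2]))
        have h2 : ¬ (D.t e = a ∧ D.s e = b) := fun h => he (D.inj _ _ (by
          rw [D.edge_spec, h.1, h.2, Sym2.eq_swap]))
        rw [if_neg h1, if_neg h2, add_zero]
      · simp
    · rw [if_neg hab, Finset.sum_eq_zero]
      intro e _
      have h1 : ¬ (D.s e = a ∧ D.t e = b) := fun h => hab (h.1 ▸ h.2 ▸ D.adj e)
      have h2 : ¬ (D.t e = a ∧ D.s e = b) := fun h => hab (h.1 ▸ h.2 ▸ (D.adj e).symm)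
      rw [if_neg h1, if_neg h2, add_zero]
  simp only [SimpleGraph.adjPairs, h1]
  simp only [Finset.sum_comm (s := (Finset.univ : Finset V)) (t := (Finset.univ : Finset D.E))]
  have h2 : ∀ p q : V, ∑ a, ∑ b, (if p = a ∧ q = b then (1 : ℤ) else 0) = 1 := by
    intro p q
    simp [ite_and]
  simp only [Finset.sum_add_distrib, h2]
  simp [two_mul]

/-- Grötzsch's theorem for graphs with an algebraic dual. -/
theorem PlaneDual.colorable_three [Fintype V] (D : PlaneDual G) (htf : G.CliqueFree 3) :
    G.Colorable 3 := by
  classical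
  induction hn : Fintype.card V using Nat.strong_induction_on generalizing V with
  | _ n ih =>
    subst hn
    by_contra hG
    have ih' : ∀ (W : Type) [Fintype W] (H : SimpleGraph W), Fintype.card W < Fintype.card V →
        Nonempty (PlaneDual H) → H.CliqueFree 3 → H.Colorable 3 :=
      fun W _ H hW ⟨D'⟩ hH => ih _ hW D' hH rfl
    have hcrit : G.CriticalOn Finset.univ := by
      refine ⟨fun h => hG (colorable_three_iff_colorableOn.2 h), fun B hB => ?_⟩
      refine colorableOn_of_colorable_induce (ih' (B : Set V) _ ?_
        (D.nonempty_of_injective Subtype.val_injective fun u v h => h) (htf.comap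
          (SimpleGraph.Copy.induce G _).isContained))
      simpa using Finset.card_lt_card hB
    have hpot := hcrit.kostochka_yancey
    have h2 := G.two_mul_potential Finset.univ
    rw [D.adjPairs_univ, Finset.card_univ] at h2
    have : Nonempty V := by
      by_contra hV
      rw [not_nonempty_iff] at hV
      exact hG ⟨SimpleGraph.Coloring.mk (fun v => isEmptyElim v) fun {v} => isEmptyElim v⟩
    obtain ⟨f, hf, hcard⟩ := D.exists_short_face (by omega)
    have htri := fun a b c => not_adj_of_cliqueFree_three htf (a := a) (b := b) (c := c)
    obtain ⟨x, y, z, u, h⟩ := D.exists_isFourFace_of_card_le htri hf hcard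
    obtain ⟨v, w, h1, h2, h3⟩ := h.exists_path htf hG ih'
    obtain ⟨v', w', h4, h5, h6⟩ := h.rotate.exists_path htf hG ih'
    exact h.not_crossing htri h1 h2 h3 h4 h5 h6

end Main

/-- Grötzsch's theorem: every triangle-free planar graph is 3-colourable. -/
theorem grotzsch {V : Type} [Fintype V]
    (G : SimpleGraph V) (hplanar : G.IsPlanar) (htf : G.CliqueFree 3) :
    G.Colorable 3 := by
  obtain ⟨P⟩ := hplanar
  obtain ⟨D⟩ := P.nonempty_planeDual
  exact D.colorable_three htf
end

section
/- There exists a triangle-free planar graph G and a list assignment L with |L(v)| = 3 for every vertex v such that G has no proper L-colouring; i.e., not every triangle-free planar graph is 3-choosable. -/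
/-- A proper colouring of `G` from the lists `L`. -/
def ProperListColoring {V : Type} (G : SimpleGraph V) (L : V → Finset ℕ) (φ : V → ℕ) : Prop :=
  (∀ v, φ v ∈ L v) ∧ ∀ u v, G.Adj u v → φ u ≠ φ v

/-! ### Straight-line drawings -/

section StraightLine

variable {V : Type}

/-- Two edges of a straight-line drawing that are weakly separated by the zero line of an affine
function meet only in common endpoints, provided that the first edge has at most the endpoint `c`
on that line, and that `c` belongs to the second edge or the second edge avoids the line. -/
lemma segment_inter_segment_subset {p : V → ℝ × ℝ} {u v x y c : V} (α β γ : ℝ) (huv : u ≠ v)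
    (hu : α * (p u).1 + β * (p u).2 + γ ≤ 0) (hv : α * (p v).1 + β * (p v).2 + γ ≤ 0)
    (hx : 0 ≤ α * (p x).1 + β * (p x).2 + γ) (hy : 0 ≤ α * (p y).1 + β * (p y).2 + γ)
    (huc : α * (p u).1 + β * (p u).2 + γ = 0 → u = c)
    (hvc : α * (p v).1 + β * (p v).2 + γ = 0 → v = c)
    (hc : c = x ∨ c = y ∨
      0 < α * (p x).1 + β * (p x).2 + γ ∧ 0 < α * (p y).1 + β * (p y).2 + γ) :
    segment ℝ (p u) (p v) ∩ segment ℝ (p x) (p y) ⊆ p '' (({u, v} : Set V) ∩ {x, y}) := by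
  rintro z ⟨⟨s, t, hs, ht, hst, hz⟩, ⟨s', t', hs', ht', hst', hz'⟩⟩
  have e : α * z.1 + β * z.2 + γ = s * (α * (p u).1 + β * (p u).2 + γ) +
      t * (α * (p v).1 + β * (p v).2 + γ) := by
    rw [← hz]; simp; linear_combination (-γ) * hst
  have e' : α * z.1 + β * z.2 + γ = s' * (α * (p x).1 + β * (p x).2 + γ) +
      t' * (α * (p y).1 + β * (p y).2 + γ) := by
    rw [← hz']; simp; linear_combination (-γ) * hst'
  set fu := α * (p u).1 + β * (p u).2 + γ
  set fv := α * (p v).1 + β * (p v).2 + γ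
  set fx := α * (p x).1 + β * (p x).2 + γ
  set fy := α * (p y).1 + β * (p y).2 + γ
  have h1 := mul_nonpos_of_nonneg_of_nonpos hs hu
  have h2 := mul_nonpos_of_nonneg_of_nonpos ht hv
  have h3 := mul_nonneg hs' hx
  have h4 := mul_nonneg ht' hy
  have hcxy : c = x ∨ c = y := by
    rcases hc with h | h | ⟨h, h'⟩
    · exact .inl h
    · exact .inr h
    · exfalso
      have h5 : s' * fx = 0 := by linarith
      have h6 : t' * fy = 0 := by linarith
      have h7 := (mul_eq_zero.1 h5).resolve_right h.ne'
      have h8 := (mul_eq_zero.1 h6).resolve_right h'.ne'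
      linarith
  have h5 : s * fu = 0 := by linarith
  have h6 : t * fv = 0 := by linarith
  rcases mul_eq_zero.1 h5 with h | h
  · have ht1 : t = 1 := by linarith
    have := hvc (by simpa [ht1] using h6)
    refine ⟨v, ⟨by simp, by rcases hcxy with h | h <;> simp [this, h]⟩, ?_⟩
    rw [← hz, h, ht1]; simp
  · have hu := huc h
    have ht0 : t = 0 := (mul_eq_zero.1 h6).resolve_right fun h' => huv (hu.trans (hvc h').symm)
    have hs1 : s = 1 := by linarith
    refine ⟨u, ⟨by simp, by rcases hcxy with h | h <;> simp [hu, h]⟩, ?_⟩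
    rw [← hz, hs1, ht0]; simp

/-- A graph without isolated vertices is planar if it has a straight-line drawing in which edges
meet only in common endpoints. -/
lemma SimpleGraph.isPlanar_of_segments {G : SimpleGraph V} (p : V → ℝ × ℝ)
    (hp : Function.Injective p) (hG : ∀ v, ∃ w, G.Adj v w)
    (h : ∀ u v x y, G.Adj u v → G.Adj x y → ({u, v} : Set V) ≠ {x, y} →
      segment ℝ (p u) (p v) ∩ segment ℝ (p x) (p y) ⊆ p '' (({u, v} : Set V) ∩ {x, y})) :
    G.IsPlanar := by
  have range_eq (u v : V) :
      Set.range (fun t : Set.Icc (0 : ℝ) 1 => AffineMap.lineMap (p u) (p v) (t : ℝ)) =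
        segment ℝ (p u) (p v) := by
    rw [segment_eq_image_lineMap, Set.image_eq_range]
  refine ⟨{
    pos := p
    arc := fun u v t => AffineMap.lineMap (p u) (p v) (t : ℝ)
    pos_inj := hp
    arc_cont := fun u v _ => by fun_prop
    arc_inj := fun u v huv => ?_
    arc_start := fun u v _ => by simp
    arc_end := fun u v _ => by simp
    arc_symm := fun u v _ => by rw [range_eq, range_eq, segment_symm]
    arc_avoid := fun u v w huv hwu hwv => ?_
    arcs_meet_only_at_endpoints := fun u v x y => by rw [range_eq, range_eq]; exact h u v x y }⟩
  · exact (AffineMap.lineMap_injective ℝ (hp.ne huv.ne)).comp Subtype.val_injective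
  · rw [range_eq]
    intro hw
    obtain ⟨x, hx⟩ := hG w
    have hne : ({u, v} : Set V) ≠ {w, x} := fun he => by
      have : w ∈ ({u, v} : Set V) := he ▸ Set.mem_insert w {x}
      exact this.elim hwu hwv
    obtain ⟨t, ⟨ht, -⟩, hpt⟩ := h u v w x huv hx hne ⟨hw, left_mem_segment ℝ _ _⟩
    rcases ht with rfl | rfl
    · exact hwu (hp hpt.symm)
    · exact hwv (hp hpt.symm)

lemma SimpleGraph.IsPlanar.comap {W : Type} {G : SimpleGraph V} (hG : G.IsPlanar) {f : W → V}
    (hf : Function.Injective f) : (G.comap f).IsPlanar := by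
  obtain ⟨E⟩ := hG
  refine ⟨{
    pos := E.pos ∘ f
    arc := fun u v => E.arc (f u) (f v)
    pos_inj := E.pos_inj.comp hf
    arc_cont := fun u v => E.arc_cont _ _
    arc_inj := fun u v => E.arc_inj _ _
    arc_start := fun u v => E.arc_start _ _
    arc_end := fun u v => E.arc_end _ _
    arc_symm := fun u v => E.arc_symm _ _
    arc_avoid := fun u v w h hu hv => E.arc_avoid _ _ _ h (hf.ne hu) (hf.ne hv)
    arcs_meet_only_at_endpoints := fun u v x y h h' hne => ?_ }⟩
  have key := E.arcs_meet_only_at_endpoints (f u) (f v) (f x) (f y) h h' (by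
    rw [← Set.image_pair, ← Set.image_pair]
    exact hf.image_injective.ne hne)
  rwa [← Set.image_pair, ← Set.image_pair, ← Set.image_inter hf, ← Set.image_comp] at key

end StraightLine

/-! ### The gadget -/

namespace Gadget

/-- The edges of the gadget. The vertices `0` and `1` are its poles, `2` and `3` are common
neighbours of the poles, `0, 5, 4, 1` is a path, and the pentagons `6, …, 10` and `11, …, 15` lie
inside the two 5-faces bounded by that path together with `2` and `3`, respectively. -/
def edges : List (Fin 16 × Fin 16) :=
  [(0, 2), (1, 2), (0, 3), (1, 3), (1, 4), (0, 5), (4, 5),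
   (6, 7), (7, 8), (8, 9), (9, 10), (10, 6), (0, 6), (2, 7), (1, 8), (4, 9), (5, 10),
   (11, 12), (12, 13), (13, 14), (14, 15), (15, 11), (0, 11), (3, 12), (1, 13), (4, 14), (5, 15)]

def graph : SimpleGraph (Fin 16) := SimpleGraph.fromRel fun k l => (k, l) ∈ edges

instance : DecidableRel graph.Adj := fun k l =>
  inferInstanceAs (Decidable (k ≠ l ∧ ((k, l) ∈ edges ∨ (l, k) ∈ edges)))

/-- The first coordinates of a straight-line drawing of the gadget. -/
def xCoord : Fin 16 → ℤ := ![0, 0, 2, 20, 10, 10, 4, 3, 4, 7, 7, 8, 15, 8, 12, 12]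

/-- The second coordinates of a straight-line drawing of the gadget. -/
def yCoord : Fin 16 → ℤ := ![20, -20, 0, 0, -4, 4, 10, 0, -10, -3, 3, 10, 1, -10, -3, 3]

/-- Twice the signed area of the triangle spanned by the vertices `k`, `l`, `m` of the drawing. -/
def orient (k l m : Fin 16) : ℤ :=
  (xCoord l - xCoord k) * (yCoord m - yCoord k) - (yCoord l - yCoord k) * (xCoord m - xCoord k)

/-- The line through `m` and `n` leaves the edge from `k` to `l` on one side. -/
def OnOneSide (k l m n : Fin 16) : Prop :=
  0 < orient m n k * orient m n l ∨ (k = m ∨ k = n) ∧ orient m n l ≠ 0 ∨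
    (l = m ∨ l = n) ∧ orient m n k ≠ 0

instance (k l m n : Fin 16) : Decidable (OnOneSide k l m n) := by
  unfold OnOneSide; infer_instance

lemma onOneSide_of_mem_edges : ∀ e ∈ edges, ∀ e' ∈ edges, e ≠ e' →
    OnOneSide e.1 e.2 e'.1 e'.2 ∨ OnOneSide e'.1 e'.2 e.1 e.2 := by
  decide +kernel

lemma adj_pole : ∀ k l, graph.Adj k l → k.val < 2 → 2 ≤ l.val := by decide +kernel

lemma exists_adj : ∀ k, ∃ l, graph.Adj k l := by decide +kernel

lemma cliqueFree : ∀ k l m, graph.Adj k l → graph.Adj k m → ¬ graph.Adj l m := by decide +kernel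

lemma coord_injective : ∀ k l, xCoord k = xCoord l → yCoord k = yCoord l → k = l := by
  decide +kernel

lemma coord_bounds : ∀ k : Fin 16, 2 ≤ k.val →
    1 ≤ xCoord k ∧ 20 * xCoord k + 21 * yCoord k < 420 ∧ 20 * xCoord k - 21 * yCoord k < 420 ∧
      -20 < yCoord k ∧ yCoord k < 20 := by
  decide +kernel

lemma xCoord_pole : ∀ k : Fin 16, k.val < 2 → xCoord k = 0 := by decide +kernel

/-- The lists of the gadget that excludes the colours `a` and `b` at the poles `0` and `1`. -/
def lists (a b : ℕ) : Fin 16 → Finset ℕ :=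
  ![{0, 1, 2}, {3, 4, 5}, {a, b, 6}, {a, b, 6}, {b, 7, 8}, {a, 7, 8},
    {a, 9, 10}, {6, 9, 10}, {b, 9, 10}, {7, 9, 10}, {8, 9, 10},
    {a, 9, 10}, {6, 9, 10}, {b, 9, 10}, {8, 9, 10}, {7, 9, 10}]

lemma lists_pole {k : Fin 16} (hk : k.val < 2) (a b a' b' : ℕ) :
    lists a b k = lists a' b' k := by
  obtain rfl | rfl : k = 0 ∨ k = 1 := by grind
  all_goals simp [lists]

lemma not_alternating_pentagon {p q c₀ c₁ c₂ c₃ c₄ : ℕ} (h₀ : c₀ = p ∨ c₀ = q)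
    (h₁ : c₁ = p ∨ c₁ = q) (h₂ : c₂ = p ∨ c₂ = q) (h₃ : c₃ = p ∨ c₃ = q) (h₄ : c₄ = p ∨ c₄ = q)
    (h₀₁ : c₀ ≠ c₁) (h₁₂ : c₁ ≠ c₂) (h₂₃ : c₂ ≠ c₃) (h₃₄ : c₃ ≠ c₄) (h₄₀ : c₄ ≠ c₀) : False := by
  grind

lemma not_colorable (a b : ℕ) (c : Fin 16 → ℕ) (hc : ∀ k, c k ∈ lists a b k)
    (hadj : ∀ k l, graph.Adj k l → c k ≠ c l) (h0 : c 0 = a) (h1 : c 1 = b) : False := by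
  have hl (k l : Fin 16) (h : graph.Adj k l := by decide) : c k ≠ c l := hadj k l h
  have h2 : c 2 = 6 := by
    have := hc 2; have := hl 0 2; have := hl 1 2
    simp [lists] at *; grind
  have h3 : c 3 = 6 := by
    have := hc 3; have := hl 0 3; have := hl 1 3
    simp [lists] at *; grind
  have h4 : c 4 = 7 ∨ c 4 = 8 := by
    have := hc 4; have := hl 1 4
    simp [lists] at *; grind
  have h5 : c 5 = 7 ∨ c 5 = 8 := by
    have := hc 5; have := hl 0 5
    simp [lists] at *; grind
  have h45 := hl 4 5
  have attached (k l : Fin 16) (h : graph.Adj l k) (hk : c k ∈ ({c l, 9, 10} : Finset ℕ)) :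
      c k = 9 ∨ c k = 10 := by
    have := hadj l k h
    simp at hk; grind
  rcases h4 with h4 | h4
  · have h5 : c 5 = 8 := by grind
    exact not_alternating_pentagon
      (attached 6 0 (by decide) (h0 ▸ hc 6)) (attached 7 2 (by decide) (h2 ▸ hc 7))
      (attached 8 1 (by decide) (h1 ▸ hc 8)) (attached 9 4 (by decide) (h4 ▸ hc 9))
      (attached 10 5 (by decide) (h5 ▸ hc 10))
      (hl 6 7) (hl 7 8) (hl 8 9) (hl 9 10) (hl 10 6)
  · have h5 : c 5 = 7 := by grind
    exact not_alternating_pentagon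
      (attached 11 0 (by decide) (h0 ▸ hc 11)) (attached 12 3 (by decide) (h3 ▸ hc 12))
      (attached 13 1 (by decide) (h1 ▸ hc 13)) (attached 14 4 (by decide) (h4 ▸ hc 14))
      (attached 15 5 (by decide) (h5 ▸ hc 15))
      (hl 11 12) (hl 12 13) (hl 13 14) (hl 14 15) (hl 15 11)

/-! ### Nine gadgets glued at their poles -/

/-- The vertices of nine copies of the gadget with their poles identified: all poles are taken from
the copy `0`. -/
abbrev Vertex : Type := {q : Fin 9 × Fin 16 // q.2.val < 2 → q.1 = 0}

/-- The inclusion of the `i`-th gadget. -/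
def incl (i : Fin 9) (k : Fin 16) : Vertex :=
  ⟨(if k.val < 2 then 0 else i, k), fun h => if_pos h⟩

lemma incl_self (q : Vertex) : incl q.1.1 q.1.2 = q := by
  obtain ⟨⟨i, k⟩, h⟩ := q
  by_cases hk : k.val < 2
  · obtain rfl : i = 0 := h hk
    simp [incl]
  · simp [incl, hk]

lemma incl_of_pole {k : Fin 16} (hk : k.val < 2) (i j : Fin 9) : incl i k = incl j k := by
  simp [incl, hk]

lemma incl_injective (i : Fin 9) : Function.Injective (incl i) := fun k l h => by
  simpa [incl] using congrArg (fun q : Vertex => q.1.2) h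

/-- The union of the nine gadgets. -/
def union : SimpleGraph Vertex where
  Adj q r := ∃ i k l, graph.Adj k l ∧ q = incl i k ∧ r = incl i l
  symm := ⟨fun _ _ ⟨i, k, l, h, hq, hr⟩ => ⟨i, l, k, h.symm, hr, hq⟩⟩
  loopless := ⟨fun _ ⟨i, _, _, h, hq, hr⟩ => h.ne (incl_injective i (hq.symm.trans hr))⟩

lemma union_adj {q r : Vertex} (h : union.Adj q r) : graph.Adj q.1.2 r.1.2 := by
  obtain ⟨i, k, l, h, rfl, rfl⟩ := h
  exact h

lemma union_cliqueFree : union.CliqueFree 3 := fun s hs => by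
  obtain ⟨u, v, w, huv, huw, hvw, -⟩ := SimpleGraph.is3Clique_iff.1 hs
  exact cliqueFree _ _ _ (union_adj huv) (union_adj huw) (union_adj hvw)

/-- The drawing of the union: the gadgets are stretched horizontally by distinct powers of `42`. -/
noncomputable def pos (q : Vertex) : ℝ × ℝ := (42 ^ q.1.1.val * xCoord q.1.2, yCoord q.1.2)

lemma pos_incl (i : Fin 9) (k : Fin 16) : pos (incl i k) = (42 ^ i.val * (xCoord k : ℝ), (yCoord k : ℝ)) := by
  by_cases hk : k.val < 2 <;> simp [pos, incl, hk, xCoord_pole]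

/-- The line through the pole with second coordinate `20 * σ` that separates the `i`-th gadget from
the later ones. -/
lemma bounds_of_nonpole {σ : ℝ} (hσ : σ = 1 ∨ σ = -1) (i : Fin 9) {k : Fin 16} (hk : 2 ≤ k.val) :
    20 * (pos (incl i k)).1 + 21 * 42 ^ i.val * σ * (pos (incl i k)).2 + -420 * 42 ^ i.val < 0 := by
  obtain ⟨-, h1, h2, -, -⟩ := coord_bounds k hk
  have h1 : (20 * xCoord k + 21 * yCoord k : ℝ) < 420 := by exact_mod_cast h1
  have h2 : (20 * xCoord k - 21 * yCoord k : ℝ) < 420 := by exact_mod_cast h2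
  have hpow : (0 : ℝ) < 42 ^ i.val := by positivity
  rw [pos_incl]
  rcases hσ with rfl | rfl <;> nlinarith

lemma bounds_of_nonpole_of_lt {σ : ℝ} (hσ : σ = 1 ∨ σ = -1) {i j : Fin 9} (hij : i < j)
    {k : Fin 16} (hk : 2 ≤ k.val) :
    0 < 20 * (pos (incl j k)).1 + 21 * 42 ^ i.val * σ * (pos (incl j k)).2 +
      -420 * 42 ^ i.val := by
  obtain ⟨h0, -, -, h1, h2⟩ := coord_bounds k hk
  have h0 : (1 : ℝ) ≤ xCoord k := by exact_mod_cast h0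
  have h1 : (-20 : ℝ) < yCoord k := by exact_mod_cast h1
  have h2 : (yCoord k : ℝ) < 20 := by exact_mod_cast h2
  have hpow : (0 : ℝ) < 42 ^ i.val := by positivity
  have hpow' : (42 ^ i.val * 42 : ℝ) ≤ 42 ^ j.val := by
    rw [← pow_succ]; exact pow_le_pow_right₀ (by norm_num) hij
  have h3 : (42 ^ i.val * 42 : ℝ) ≤ 42 ^ j.val * xCoord k := by nlinarith
  rw [pos_incl]
  rcases hσ with rfl | rfl <;> nlinarith

lemma segment_inter_of_lt {i j : Fin 9} (hij : i < j) {k l m n : Fin 16} (h : graph.Adj k l)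
    (h' : graph.Adj m n) :
    segment ℝ (pos (incl i k)) (pos (incl i l)) ∩ segment ℝ (pos (incl j m)) (pos (incl j n)) ⊆
      pos '' (({incl i k, incl i l} : Set Vertex) ∩ {incl j m, incl j n}) := by
  have hpow : (0 : ℝ) < 42 ^ i.val := by positivity
  obtain ⟨c, σ, hc, hσ, hcσ, hmn⟩ : ∃ (c : Fin 16) (σ : ℝ), c.val < 2 ∧ (σ = 1 ∨ σ = -1) ∧
      (yCoord c : ℝ) = 20 * σ ∧ (m = c ∨ 2 ≤ m.val) ∧ (n = c ∨ 2 ≤ n.val) := by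
    by_cases h1 : m = 1 ∨ n = 1
    · refine ⟨1, -1, by simp, .inr rfl, by simp [yCoord], ?_⟩
      have := adj_pole _ _ h'; have := adj_pole _ _ h'.symm
      grind
    · refine ⟨0, 1, by simp, .inl rfl, by simp [yCoord], ?_⟩
      grind
  have pole (s : Fin 16) (hs : s.val < 2) : s = c ∨ (yCoord s : ℝ) = -(20 * σ) := by
    obtain rfl | rfl : s = 0 ∨ s = 1 := by grind
    all_goals obtain rfl | rfl : c = 0 ∨ c = 1 := by grind
    all_goals simp [← hcσ, yCoord]
  have hi (s : Fin 16) : s = c ∨ 20 * (pos (incl i s)).1 +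
      21 * 42 ^ i.val * σ * (pos (incl i s)).2 + -420 * 42 ^ i.val < 0 := by
    by_cases hs : s.val < 2
    · refine (pole s hs).imp_right fun hy => ?_
      rw [pos_incl, xCoord_pole s hs, hy]
      rcases hσ with rfl | rfl <;> simp <;> linarith
    · exact .inr (bounds_of_nonpole hσ i (by omega))
  have hzero (t : Fin 9) : 20 * (pos (incl t c)).1 +
      21 * 42 ^ i.val * σ * (pos (incl t c)).2 + -420 * 42 ^ i.val = 0 := by
    rw [pos_incl, xCoord_pole c hc, hcσ]
    rcases hσ with rfl | rfl <;> simp <;> ring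
  have hj (s : Fin 16) (hs : 2 ≤ s.val) := bounds_of_nonpole_of_lt hσ hij hs
  refine segment_inter_segment_subset (c := incl i c) 20 (21 * 42 ^ i.val * σ) (-420 * 42 ^ i.val)
    ((incl_injective i).ne h.ne) ?_ ?_ ?_ ?_ ?_ ?_ ?_
  · rcases hi k with rfl | h
    exacts [(hzero i).le, h.le]
  · rcases hi l with rfl | h
    exacts [(hzero i).le, h.le]
  · rcases hmn.1 with rfl | h
    exacts [(hzero j).ge, (hj m h).le]
  · rcases hmn.2 with rfl | h
    exacts [(hzero j).ge, (hj n h).le]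
  · exact fun h => congrArg _ ((hi k).resolve_right h.not_lt)
  · exact fun h => congrArg _ ((hi l).resolve_right h.not_lt)
  · rcases hmn with ⟨rfl | hm, rfl | hn⟩
    exacts [.inl (incl_of_pole hc i j), .inl (incl_of_pole hc i j),
      .inr (.inl (incl_of_pole hc i j)), .inr (.inr ⟨hj m hm, hj n hn⟩)]

lemma segment_inter_of_onOneSide (i : Fin 9) {k l m n : Fin 16} (hkl : k ≠ l)
    (h : OnOneSide k l m n) :
    segment ℝ (pos (incl i k)) (pos (incl i l)) ∩ segment ℝ (pos (incl i m)) (pos (incl i n)) ⊆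
      pos '' (({incl i k, incl i l} : Set Vertex) ∩ {incl i m, incl i n}) := by
  have hpow : (0 : ℝ) < 42 ^ i.val := by positivity
  suffices key : ∀ (σ : ℤ) (c : Fin 16), σ * orient m n k ≤ 0 → σ * orient m n l ≤ 0 →
      (σ * orient m n k = 0 → k = c) → (σ * orient m n l = 0 → l = c) →
      (c = m ∨ c = n) →
      segment ℝ (pos (incl i k)) (pos (incl i l)) ∩ segment ℝ (pos (incl i m)) (pos (incl i n)) ⊆
        pos '' (({incl i k, incl i l} : Set Vertex) ∩ {incl i m, incl i n}) by
    rcases h with h | ⟨hk, hl⟩ | ⟨hl, hk⟩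
    · rcases pos_and_pos_or_neg_and_neg_of_mul_pos h with ⟨h1, h2⟩ | ⟨h1, h2⟩
      · exact key (-1) m (by omega) (by omega) (by omega) (by omega) (.inl rfl)
      · exact key 1 m (by omega) (by omega) (by omega) (by omega) (.inl rfl)
    · have h0 : orient m n k = 0 := by rcases hk with rfl | rfl <;> (simp [orient]; try ring)
      rcases hl.lt_or_gt with hl | hl
      · exact key 1 k (by omega) (by omega) (fun _ => rfl) (by omega) hk
      · exact key (-1) k (by omega) (by omega) (fun _ => rfl) (by omega) hk
    · have h0 : orient m n l = 0 := by rcases hl with rfl | rfl <;> (simp [orient]; try ring)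
      rcases hk.lt_or_gt with hk | hk
      · exact key 1 l (by omega) (by omega) (by omega) (fun _ => rfl) hl
      · exact key (-1) l (by omega) (by omega) (by omega) (fun _ => rfl) hl
  intro σ c hk hl hkc hlc hc
  have value (s : Fin 16) :
      -σ * (yCoord n - yCoord m) * (pos (incl i s)).1 +
        42 ^ i.val * σ * (xCoord n - xCoord m) * (pos (incl i s)).2 +
        42 ^ i.val * σ * ((yCoord n - yCoord m) * xCoord m - (xCoord n - xCoord m) * yCoord m) =
      42 ^ i.val * ((σ * orient m n s : ℤ) : ℝ) := by
    rw [pos_incl, orient]; push_cast; ring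
  have zero_left : orient m n m = 0 := by simp [orient]
  have zero_right : orient m n n = 0 := by simp [orient]; ring
  refine segment_inter_segment_subset (c := incl i c) _ _ _ ((incl_injective i).ne hkl)
    ((value k).trans_le ?_) ((value l).trans_le ?_) ((value m).ge.trans' ?_)
    ((value n).ge.trans' ?_) (fun h => ?_) (fun h => ?_) ?_
  · exact mul_nonpos_of_nonneg_of_nonpos hpow.le (by exact_mod_cast hk)
  · exact mul_nonpos_of_nonneg_of_nonpos hpow.le (by exact_mod_cast hl)
  · simp [zero_left]
  · simp [zero_right]
  · rw [value, mul_eq_zero, or_iff_right hpow.ne'] at h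
    rw [hkc (by exact_mod_cast h)]
  · rw [value, mul_eq_zero, or_iff_right hpow.ne'] at h
    rw [hlc (by exact_mod_cast h)]
  · rcases hc with rfl | rfl <;> simp

lemma segment_inter_same (i : Fin 9) {k l m n : Fin 16} (h : graph.Adj k l)
    (h' : graph.Adj m n) (hne : ({incl i k, incl i l} : Set Vertex) ≠ {incl i m, incl i n}) :
    segment ℝ (pos (incl i k)) (pos (incl i l)) ∩ segment ℝ (pos (incl i m)) (pos (incl i n)) ⊆
      pos '' (({incl i k, incl i l} : Set Vertex) ∩ {incl i m, incl i n}) := by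
  wlog he : (k, l) ∈ edges generalizing k l
  · rw [segment_symm, Set.pair_comm]
    exact this h.symm (by rwa [Set.pair_comm]) (h.2.resolve_left he)
  wlog he' : (m, n) ∈ edges generalizing m n
  · rw [segment_symm ℝ (pos (incl i m)), Set.pair_comm (incl i m)]
    exact this h'.symm (by rwa [Set.pair_comm (incl i n)]) (h'.2.resolve_left he')
  rcases onOneSide_of_mem_edges _ he _ he' (by rintro ⟨⟩; exact hne rfl) with hs | hs
  · exact segment_inter_of_onOneSide i h.ne hs
  · rw [Set.inter_comm, Set.inter_comm {incl i k, incl i l}]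
    exact segment_inter_of_onOneSide i h'.ne hs

lemma pos_injective : Function.Injective pos := by
  have pos_ne {i j : Fin 9} (hij : i < j) {k l : Fin 16} (hk : 2 ≤ k.val) (hl : 2 ≤ l.val) :
      pos (incl i k) ≠ pos (incl j l) := fun h => by
    have h1 := bounds_of_nonpole (.inl rfl) i hk
    have h2 := bounds_of_nonpole_of_lt (.inl rfl) hij hl
    rw [h] at h1
    exact h1.not_gt h2
  have fst_pos (i : Fin 9) {k : Fin 16} (hk : 2 ≤ k.val) : 0 < (pos (incl i k)).1 := by
    have : (1 : ℝ) ≤ xCoord k := by exact_mod_cast (coord_bounds k hk).1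
    rw [pos_incl]; positivity
  have fst_pole (i : Fin 9) {k : Fin 16} (hk : k.val < 2) : (pos (incl i k)).1 = 0 := by
    simp [pos_incl, xCoord_pole k hk]
  have same {i : Fin 9} {k l : Fin 16} (h : pos (incl i k) = pos (incl i l)) : k = l := by
    simp only [pos_incl, Prod.mk.injEq, mul_eq_mul_left_iff, Int.cast_inj] at h
    exact coord_injective k l (h.1.resolve_right (by positivity)) h.2
  intro q r h
  obtain ⟨i, k, rfl⟩ : ∃ i k, q = incl i k := ⟨_, _, (incl_self q).symm⟩
  obtain ⟨j, l, rfl⟩ : ∃ j l, r = incl j l := ⟨_, _, (incl_self r).symm⟩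
  rcases lt_or_ge k.val 2 with hk | hk <;> rcases lt_or_ge l.val 2 with hl | hl
  · rw [incl_of_pole hk i j] at h ⊢
    rw [same h]
  · exact absurd (congrArg Prod.fst h) ((fst_pole i hk).trans_ne (fst_pos j hl).ne)
  · exact absurd (congrArg Prod.fst h) ((fst_pole j hl).trans_ne (fst_pos i hk).ne).symm
  · rcases lt_trichotomy i j with hij | rfl | hij
    · exact absurd h (pos_ne hij hk hl)
    · rw [same h]
    · exact absurd h.symm (pos_ne hij hl hk)

lemma union_isPlanar : union.IsPlanar := by
  refine SimpleGraph.isPlanar_of_segments pos pos_injective (fun q => ?_) ?_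
  · obtain ⟨l, hl⟩ := exists_adj q.1.2
    exact ⟨incl q.1.1 l, q.1.1, q.1.2, l, hl, (incl_self q).symm, rfl⟩
  · rintro _ _ _ _ ⟨i, k, l, h, rfl, rfl⟩ ⟨j, m, n, hmn, rfl, rfl⟩ hne
    rcases lt_trichotomy i j with hij | rfl | hij
    · exact segment_inter_of_lt hij h hmn
    · exact segment_inter_same i h hmn hne
    · rw [Set.inter_comm, Set.inter_comm {incl i k, incl i l}]
      exact segment_inter_of_lt hij hmn h

/-- The lists of the union: every pair of colours of the poles is excluded by one gadget. -/
def unionLists (q : Vertex) : Finset ℕ := lists (q.1.1 / 3) (3 + q.1.1 % 3) q.1.2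

lemma card_unionLists (q : Vertex) : (unionLists q).card = 3 := by
  have : ∀ (i : Fin 9) (k : Fin 16), (lists (i / 3) (3 + i % 3) k).card = 3 := by decide +kernel
  exact this _ _

lemma unionLists_incl (i : Fin 9) (k : Fin 16) :
    unionLists (incl i k) = lists (i / 3) (3 + i % 3) k := by
  by_cases hk : k.val < 2
  · exact lists_pole hk _ _ _ _
  · simp [unionLists, incl, hk]

lemma union_not_colorable (φ : Vertex → ℕ) : ¬ ProperListColoring union unionLists φ := by
  rintro ⟨hL, hadj⟩
  obtain ⟨i, h0, h1⟩ : ∃ i : Fin 9, φ (incl 0 0) = i / 3 ∧ φ (incl 0 1) = 3 + i % 3 := by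
    have h0 : φ (incl 0 0) ∈ ({0, 1, 2} : Finset ℕ) := hL (incl 0 0)
    have h1 : φ (incl 0 1) ∈ ({3, 4, 5} : Finset ℕ) := hL (incl 0 1)
    simp only [Finset.mem_insert, Finset.mem_singleton] at h0 h1
    refine ⟨⟨3 * φ (incl 0 0) + (φ (incl 0 1) - 3), by omega⟩, ?_, ?_⟩ <;> simp <;> omega
  exact not_colorable _ _ (fun k => φ (incl i k)) (fun k => unionLists_incl i k ▸ hL (incl i k))
    (fun k l h => hadj _ _ ⟨i, k, l, h, rfl, rfl⟩) h0 h1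

end Gadget

/-- there is a triangle-free planar graph that is not 3-choosable. -/
theorem exists_trianglefree_planar_not_3_choosable :
    ∃ (n : ℕ) (G : SimpleGraph (Fin n)), G.IsPlanar ∧ G.CliqueFree 3 ∧
      ∃ L : Fin n → Finset ℕ, (∀ v, (L v).card = 3) ∧
        ¬ ∃ φ : Fin n → ℕ, ProperListColoring G L φ := by
  let e := (Fintype.equivFin Gadget.Vertex).symm
  refine ⟨_, Gadget.union.comap e, Gadget.union_isPlanar.comap e.injective,
    Gadget.union_cliqueFree.comap (SimpleGraph.Embedding.comap e.toEmbedding _).isContained,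
    Gadget.unionLists ∘ e, fun v => Gadget.card_unionLists _, ?_⟩
  rintro ⟨φ, hL, hadj⟩
  refine Gadget.union_not_colorable (φ ∘ e.symm) ⟨fun q => ?_, fun q r h => hadj _ _ ?_⟩
  · simpa using hL (e.symm q)
  · simpa using h
end
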